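/- For every γ > 0 there is a constant C such that if p ≥ C·log n/n, then a.a.s. Γ = G(n,p) has the following property: every spanning subgraph G ⊆ Γ obtained by deleting, at each vertex v, at most (1/2 − γ)·deg_Γ(v) of the edges incident to v, contains a Hamilton cycle. In other words, the local resilience of G(n,p) with respect to Hamiltonicity is a.a.s. at least 1/2 − γ. -/

import Mathlib

open MeasureTheory Filter Topology

/-- Bernoulli measure on `Bool` with success probability `p` (clamped to `[0,1]`). -/
noncomputable def bernoulliMeasure (p : ℝ) : Measure Bool :=
  (min (ENNReal.ofReal p) 1) • Measure.dirac true +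
    (1 - min (ENNReal.ofReal p) 1) • Measure.dirac false

/-- The distribution of the binomial random graph `G(n,p)`, as a product of independent
Bernoulli measures, one for each potential edge. -/
noncomputable def gnp (n : ℕ) (p : ℝ) : Measure (Sym2 (Fin n) → Bool) :=
  Measure.pi fun _ => bernoulliMeasure p

/-- The simple graph on `[n]` determined by an outcome of the edge indicators. -/
def graphOf {n : ℕ} (ω : Sym2 (Fin n) → Bool) : SimpleGraph (Fin n) :=
  SimpleGraph.fromRel fun u v => ω s(u, v) = true

/-- `G` contains a (not necessarily induced) copy of `H`. -/
def ContainsCopy {α β : Type*} (H : SimpleGraph α) (G : SimpleGraph β) : Prop :=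
  ∃ f : α → β, Function.Injective f ∧ ∀ ⦃u v⦄, H.Adj u v → G.Adj (f u) (f v)

/-- The maximum degree of a graph on a finite vertex type. -/
noncomputable def maxDeg {V : Type*} [Fintype V] (G : SimpleGraph V) : ℕ :=
  Finset.univ.sup fun v => (G.neighborSet v).ncard

/-- The maximum 0-density `m₀(H)`. -/
noncomputable def m0 {V : Type*} [Fintype V] (H : SimpleGraph V) : ℝ :=
  sSup {x : ℝ | ∃ H' : H.Subgraph, H'.verts.Nonempty ∧
    x = (H'.edgeSet.ncard : ℝ) / (H'.verts.ncard : ℝ)}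

/-- The maximum 1-density `m₁(H)`. -/
noncomputable def m1 {V : Type*} [Fintype V] (H : SimpleGraph V) : ℝ :=
  sSup {x : ℝ | ∃ H' : H.Subgraph, 1 < H'.verts.ncard ∧
    x = (H'.edgeSet.ncard : ℝ) / ((H'.verts.ncard : ℝ) - 1)}

/-- The maximum 2-density `m₂(H)`. -/
noncomputable def m2 {V : Type*} [Fintype V] (H : SimpleGraph V) : ℝ :=
  sSup {x : ℝ | ∃ H' : H.Subgraph, 0 < H'.edgeSet.ncard ∧
    x = if 2 < H'.verts.ncard
      then ((H'.edgeSet.ncard : ℝ) - 1) / ((H'.verts.ncard : ℝ) - 2)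
      else 1 / 2}

/-- The maximum Riordan-density `m_R(H)`. -/
noncomputable def mR {V : Type*} [Fintype V] (H : SimpleGraph V) : ℝ :=
  sSup {x : ℝ | ∃ H' : H.Subgraph, 2 < H'.verts.ncard ∧
    x = (H'.edgeSet.ncard : ℝ) / ((H'.verts.ncard : ℝ) - 2)}

/-- The local 1-density `m₁(x,H)` of `H` at the vertex `x`. -/
noncomputable def m1At {V : Type*} [Fintype V] (H : SimpleGraph V) (x : V) : ℝ :=
  sSup {r : ℝ | ∃ H' : H.Subgraph, x ∈ H'.verts ∧ 1 < H'.verts.ncard ∧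
    r = (H'.edgeSet.ncard : ℝ) / ((H'.verts.ncard : ℝ) - 1)}

/-- `H` is strictly 1-balanced: `H` itself is the unique maximiser of the 1-density. -/
def StrictlyOneBalanced {V : Type*} [Fintype V] (H : SimpleGraph V) : Prop :=
  ∀ H' : H.Subgraph, 1 < H'.verts.ncard → H' ≠ ⊤ →
    (H'.edgeSet.ncard : ℝ) / ((H'.verts.ncard : ℝ) - 1) <
      (H.edgeSet.ncard : ℝ) / ((Fintype.card V : ℝ) - 1)

/-- `H` is vertex-1-balanced: the local 1-density at every vertex equals `m₁(H)`. -/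
def VertexOneBalanced {V : Type*} [Fintype V] (H : SimpleGraph V) : Prop :=
  ∀ x : V, m1At H x = m1 H

/-- `G` (an `n`-vertex graph) contains an `H`-factor: `⌊n / v(H)⌋` pairwise vertex-disjoint
copies of `H`. -/
def HasFactor {V : Type*} [Fintype V] (H : SimpleGraph V) {n : ℕ}
    (G : SimpleGraph (Fin n)) : Prop :=
  ∃ f : Fin (n / Fintype.card V) × V → Fin n, Function.Injective f ∧
    ∀ (i : Fin (n / Fintype.card V)) ⦃u v : V⦄, H.Adj u v → G.Adj (f (i, u)) (f (i, v))


section partB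
open Finset

theorem sublist_app_cases {α : Type*} {I a b : List α} (h : I <:+: a ++ b) :
    I <:+: a ∨ I <:+: b ∨ ∃ a1 b1, a1 ≠ [] ∧ b1 ≠ [] ∧ I = a1 ++ b1 ∧ a1 <:+ a ∧ b1 <+: b := by
  obtain ⟨s, t, h⟩ := h
  rw [List.append_assoc, List.append_eq_append_iff] at h
  rcases h with ⟨c, h1, h2⟩ | ⟨c, h1, h2⟩
  · rw [List.append_eq_append_iff] at h2
    rcases h2 with ⟨d, h3, h4⟩ | ⟨d, h3, h4⟩
    · left; exact ⟨s, d, by rw [h1, h3]; simp⟩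
    · rcases eq_or_ne c [] with rfl | hc
      · right; left; exact ⟨[], t, by simp [h3, h4]⟩
      rcases eq_or_ne d [] with rfl | hd
      · left; exact ⟨s, [], by simp [h3, h1]⟩
      right; right
      exact ⟨c, d, hc, hd, h3, ⟨s, h1.symm⟩, ⟨t, h4.symm⟩⟩
  · right; left; exact ⟨c, t, by rw [h2]; simp⟩

section rot
variable {V : Type*}

/-- Lists obtained from `P` by at most `t` Pósa rotations (moving endpoint is the head). -/
inductive Reach (R : SimpleGraph V) (P : List V) : ℕ → List V → Prop
  | base : Reach R P 0 P
  | stay {t Q} : Reach R P t Q → Reach R P (t + 1) Q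
  | rot {t x a w b} : Reach R P t (x :: a ++ w :: b) → R.Adj x w →
      Reach R P (t + 1) ((x :: a).reverse ++ w :: b)

def EndS (R : SimpleGraph V) (P : List V) (t : ℕ) (x : V) : Prop := ∃ Q, Reach R P t (x :: Q)

def Cons2 (P : List V) (y w : V) : Prop := [y, w] <:+: P ∨ [w, y] <:+: P

def ZS (R : SimpleGraph V) (P : List V) (t : ℕ) (w : V) : Prop :=
  EndS R P t w ∨ ∃ y, EndS R P t y ∧ Cons2 P y w

def PathL (R : SimpleGraph V) (Q : List V) : Prop := Q.IsChain R.Adj ∧ Q.Nodup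

def LongL (R : SimpleGraph V) (Q : List V) : Prop :=
  PathL R Q ∧ ∀ Q', PathL R Q' → Q'.length ≤ Q.length

variable {R R' : SimpleGraph V} {P Q : List V} {t : ℕ}

theorem EndS.succ {x : V} (h : EndS R P t x) : EndS R P (t + 1) x := by
  obtain ⟨Q, h⟩ := h; exact ⟨Q, h.stay⟩

theorem ZS.succ {x : V} (h : ZS R P t x) : ZS R P (t + 1) x := by
  rcases h with h | ⟨y, h, h'⟩
  · exact Or.inl h.succ
  · exact Or.inr ⟨y, h.succ, h'⟩

theorem Reach.perm (h : Reach R P t Q) : Q.Perm P := by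
  induction h with
  | base => exact List.Perm.refl _
  | stay _ ih => exact ih
  | rot _ _ ih => exact ((List.reverse_perm _).append_right _).trans ih

theorem rot_last {x : V} {a : List V} : ∃ y c, x :: a = c ++ [y] := by
  rcases List.eq_nil_or_concat (x :: a) with h | ⟨c, y, h⟩
  · simp at h
  · exact ⟨y, c, by simpa using h⟩

theorem Reach.last (h : Reach R P t Q) : Q.getLast? = P.getLast? := by
  induction h with
  | base => rfl
  | stay _ ih => exact ih
  | rot _ _ ih =>
    rw [← ih, List.getLast?_append, List.getLast?_append, List.getLast?_eq_some_getLast (List.cons_ne_nil _ _)]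
    simp

theorem Reach.chain (hR : R ≤ R') (hP : P.IsChain R'.Adj) (h : Reach R P t Q) :
    Q.IsChain R'.Adj := by
  induction h with
  | base => exact hP
  | stay _ ih => exact ih
  | @rot t x a w b _ hx ih =>
    rw [List.isChain_append] at ih ⊢
    refine ⟨?_, ih.2.1, ?_⟩
    · rw [List.isChain_reverse]
      refine ih.1.imp ?_
      intro a b hab; exact hab.symm
    · intro u hu v hv
      simp at hu hv
      subst hu hv
      exact hR hx

theorem rot_end {x : V} {a b : List V} {w : V} (h : Reach R P t (x :: a ++ w :: b))
    (hx : R.Adj x w) : ∃ y, EndS R P (t + 1) y ∧ [y, w] <:+: x :: a ++ w :: b := by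
  obtain ⟨y, c, hc⟩ := rot_last (x := x) (a := a)
  have := Reach.rot h hx
  refine ⟨y, ⟨c.reverse ++ w :: b, ?_⟩, ?_⟩
  · rw [hc] at this; simpa using this
  · rw [hc]; exact ⟨c, b, by simp⟩

theorem Reach.inv (h : Reach R P t Q) :
    ∀ y w, [y, w] <:+: Q → Cons2 P y w ∨ (ZS R P t y ∧ ZS R P t w) := by
  induction h with
  | base => intro y w h; exact Or.inl (Or.inl h)
  | stay _ ih => intro y w h; exact (ih y w h).imp id (fun h => ⟨h.1.succ, h.2.succ⟩)
  | @rot t x a w b h hx ih =>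
    intro y z hyz
    rcases sublist_app_cases hyz with h1 | h1 | ⟨a1, b1, ha, hb, e, h2, h3⟩
    · have h1' : [z, y] <:+: x :: a ++ w :: b := by
        have := h1.reverse
        simp only [List.reverse_reverse] at this
        exact List.IsInfix.trans (by simpa using this) ⟨[], w :: b, by simp⟩
      rcases ih z y h1' with h | h
      · exact Or.inl h.symm
      · exact Or.inr ⟨h.2.succ, h.1.succ⟩
    · rcases ih y z (h1.trans ⟨x :: a, [], by simp⟩) with h | h
      · exact Or.inl h
      · exact Or.inr ⟨h.1.succ, h.2.succ⟩
    · have hl : a1.length = 1 ∧ b1.length = 1 := by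
        have := congrArg List.length e
        have h1 := List.length_pos_iff.mpr ha
        have h2 := List.length_pos_iff.mpr hb
        simp at this; omega
      obtain ⟨⟨u, rfl⟩, ⟨v, rfl⟩⟩ := And.intro (List.length_eq_one_iff.mp hl.1) (List.length_eq_one_iff.mp hl.2)
      simp at e
      obtain ⟨rfl, rfl⟩ := e
      have hy : y = x := by
        have : [y] <:+ a.reverse ++ [x] := by simpa using h2
        obtain ⟨s, hs⟩ := this
        have := congrArg List.getLast? hs
        simpa using this
      have hz : z = w := by
        obtain ⟨s, hs⟩ := h3; simp at hs; exact hs.1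
      subst hy hz
      right
      refine ⟨Or.inl ⟨_, h.stay⟩, ?_⟩
      obtain ⟨y', hy', hin⟩ := rot_end h hx
      rcases ih y' z hin with h | h
      · exact Or.inr ⟨y', hy', h⟩
      · exact h.2.succ

theorem step_Z {x w : V} {Q : List V} (h : Reach R P t (x :: Q)) (hx : R.Adj x w) (hw : w ∈ P) :
    ZS R P (t + 1) w := by
  have hwQ : w ∈ x :: Q := h.perm.mem_iff.mpr hw
  have hwQ' : w ∈ Q := by
    rcases List.mem_cons.mp hwQ with rfl | h
    · exact absurd hx (by simp)
    · exact h
  obtain ⟨a, b, rfl⟩ := List.append_of_mem hwQ'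
  obtain ⟨y', hy', hin⟩ := rot_end (a := a) (b := b) h hx
  rcases h.inv y' w hin with h | h
  · exact Or.inr ⟨y', hy', h⟩
  · exact h.2.succ

/-- predecessor inside an intact interval becomes an endpoint -/
theorem step_interval {x y w : V} {Q J : List V} (h : Reach R P t (x :: Q)) (hP : P.Nodup)
    (hx : R.Adj x w) (hJ : J <:+: x :: Q) (hyw : [y, w] <:+: J) : EndS R P (t + 1) y := by
  obtain ⟨s, b, hs⟩ := hyw.trans hJ
  have hnd : (x :: Q).Nodup := h.perm.nodup_iff.mpr hP
  have hs' : (s ++ [y]) ++ w :: b = x :: Q := by rw [← hs]; simp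
  obtain ⟨a, ha⟩ : ∃ a, s ++ [y] = x :: a := by
    rcases s with _ | ⟨s0, s⟩
    · simp at hs'; exact ⟨[], by simp [hs'.1]⟩
    · simp at hs'; exact ⟨s ++ [y], by simp [hs'.1]⟩
  rw [ha] at hs'
  rw [← hs'] at h
  have := Reach.rot h hx
  rw [← ha] at this
  exact ⟨s.reverse ++ w :: b, by simpa using this⟩

theorem longest_nbr_mem (hR : R ≤ R') (hP : LongL R' P) {x w : V} {Q : List V}
    (h : Reach R P t (x :: Q)) (hx : R.Adj x w) : w ∈ P := by
  by_contra hw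
  have h1 := hP.2 (w :: x :: Q) ⟨?_, ?_⟩
  · have := h.perm.length_eq
    simp at h1 this; omega
  · rw [List.isChain_cons_cons]
    exact ⟨(hR hx).symm, h.chain hR hP.1.1⟩
  · rw [List.nodup_cons]
    exact ⟨fun h' => hw (h.perm.mem_iff.mp h'), h.perm.nodup_iff.mpr hP.1.2⟩

theorem Reach.long (hR : R ≤ R') (hP : LongL R' P) (h : Reach R P t Q) : LongL R' Q := by
  refine ⟨⟨h.chain hR hP.1.1, h.perm.nodup_iff.mpr hP.1.2⟩, fun Q' hQ' => ?_⟩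
  rw [h.perm.length_eq]; exact hP.2 Q' hQ'

variable [DecidableEq V]

theorem chunk_idx {L i : ℕ} (hP : P.Nodup) (hL : 0 < L) {w : V}
    (hw : w ∈ (P.drop (i * L)).take L) : P.idxOf w / L = i := by
  rw [List.mem_iff_getElem] at hw
  obtain ⟨j, hj, rfl⟩ := hw
  simp only [List.getElem_take, List.getElem_drop]
  simp at hj
  rw [hP.idxOf_getElem]
  rw [mul_comm, Nat.mul_add_div hL, Nat.div_eq_of_lt hj.1]; simp

theorem mem_chunk {L : ℕ} (hL : 0 < L) {w : V} (hw : w ∈ P) :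
    w ∈ (P.drop (P.idxOf w / L * L)).take L := by
  have h1 := List.idxOf_lt_length_of_mem hw
  have h2 := Nat.div_add_mod' (P.idxOf w) L
  have h3 := Nat.mod_lt (P.idxOf w) hL
  rw [List.mem_iff_getElem]
  refine ⟨P.idxOf w % L, by simp; omega, ?_⟩
  simp only [List.getElem_take, List.getElem_drop, h2]
  exact List.getElem_idxOf _

def Good (P Q : List V) (L i : ℕ) : Prop :=
  (P.drop (i * L)).take L <:+: Q ∨ ((P.drop (i * L)).take L).reverse <:+: Q

open Classical in
theorem Reach.bad (hP : P.Nodup) {L : ℕ} (hL : 0 < L) (k : ℕ) (h : Reach R P t Q) :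
    ((range k).filter fun i => ¬ Good P Q L i).card ≤ t := by
  induction h with
  | base =>
    simp only [Nat.le_zero, Finset.card_eq_zero]
    apply Finset.filter_false_of_mem
    intro i _; simp only [not_not]
    left
    exact (List.take_prefix _ _).isInfix.trans (List.drop_suffix _ _).isInfix
  | stay _ ih => omega
  | @rot t x a w b h hx ih =>
    have key : ((range k).filter fun i => ¬ Good P ((x :: a).reverse ++ w :: b) L i) ⊆
        insert (P.idxOf w / L) ((range k).filter fun i => ¬ Good P (x :: a ++ w :: b) L i) := by
      intro i hi
      simp only [mem_filter, mem_insert] at hi ⊢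
      by_contra hcon
      push Not at hcon
      have hg := hcon.2 hi.1
      apply hi.2
      have aux : ∀ J : List V, J <:+: x :: a ++ w :: b → w ∉ J →
          J <:+: (x :: a).reverse ++ w :: b ∨ J.reverse <:+: (x :: a).reverse ++ w :: b := by
        intro J hJ hw
        rcases sublist_app_cases hJ with h1 | h1 | ⟨a1, b1, ha, hb, e, h2, h3⟩
        · right; exact h1.reverse.trans ⟨[], w :: b, by simp⟩
        · left; exact h1.trans ⟨(x :: a).reverse, [], by simp⟩
        · exfalso; apply hw
          rcases b1 with _ | ⟨b0, b1⟩
          · exact absurd rfl hb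
          obtain ⟨s, hs⟩ := h3
          simp at hs; rw [e, ← hs.1]; simp
      have hw : w ∉ (P.drop (i * L)).take L := fun h' => hcon.1 (chunk_idx hP hL h').symm
      rcases hg with hg | hg
      · exact aux _ hg hw
      · rcases aux _ hg (by simpa using hw) with h | h
        · exact Or.inr h
        · left; simpa using h
    calc _ ≤ _ := card_le_card key
      _ ≤ _ := card_insert_le _ _
      _ ≤ _ := by omega

end rot
end partB

section partC
open Finset

section cnt
variable {V : Type*} [Fintype V] [DecidableEq V]

open Classical in
noncomputable def eG (R : SimpleGraph V) (A B : Finset V) : ℕ :=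
  ((A ×ˢ B).filter fun x => R.Adj x.1 x.2).card

open Classical in
noncomputable def nb (R : SimpleGraph V) (x : V) : Finset V := univ.filter fun w => R.Adj x w

open Classical in
noncomputable def nbS (R : SimpleGraph V) (A : Finset V) : Finset V :=
  univ.filter fun w => ∃ x ∈ A, R.Adj x w

open Classical in
noncomputable def Sf (R : SimpleGraph V) (P : List V) (t : ℕ) : Finset V :=
  univ.filter fun x => EndS R P t x

variable {R R' : SimpleGraph V} {P : List V} {t : ℕ}

theorem mem_nb {x w : V} : w ∈ nb R x ↔ R.Adj x w := by simp [nb]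

theorem mem_Sf {x : V} : x ∈ Sf R P t ↔ EndS R P t x := by simp [Sf]

theorem eG_eq_sum (A B : Finset V) : eG R A B = ∑ x ∈ A, (nb R x ∩ B).card := by
  classical
  unfold eG
  rw [Finset.card_filter, Finset.sum_product]
  refine Finset.sum_congr rfl fun x _ => ?_
  rw [← Finset.card_filter]
  congr 1
  ext w; simp [nb, and_comm]

theorem eG_mono_set {A B B' : Finset V} (h : ∀ x ∈ A, ∀ w ∈ B, R.Adj x w → w ∈ B') :
    eG R A B ≤ eG R A B' := by
  rw [eG_eq_sum, eG_eq_sum]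
  refine Finset.sum_le_sum fun x hx => card_le_card ?_
  intro w hw
  simp only [mem_inter, mem_nb] at hw ⊢
  exact ⟨hw.1, h x hx w hw.2 hw.1⟩

theorem pair_idx {y w : V} (hP : P.Nodup) (h : [y, w] <:+: P) :
    P[P.idxOf y + 1]? = some w := by
  obtain ⟨s, t, rfl⟩ := h
  have hy : y ∉ s := by
    intro hy
    have h1 := (List.nodup_append.mp (List.nodup_append.mp hP).1).2.2
    exact h1 y hy y (by simp) rfl
  have : (s ++ [y, w] ++ t).idxOf y = s.length := by
    rw [List.append_assoc, List.idxOf_append_of_notMem hy]; simp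
  rw [this, List.append_assoc, List.getElem?_append_right (by omega)]
  simp

theorem pair_unique {y w w' : V} (hP : P.Nodup) (h : [y, w] <:+: P) (h' : [y, w'] <:+: P) :
    w = w' := by
  have := pair_idx hP h
  rw [pair_idx hP h'] at this
  simpa using this.symm

theorem pair_unique' {y y' w : V} (hP : P.Nodup) (h : [y, w] <:+: P) (h' : [y', w] <:+: P) :
    y = y' := by
  have h1 : [w, y] <:+: P.reverse := by simpa using h.reverse
  have h2 : [w, y'] <:+: P.reverse := by simpa using h'.reverse
  exact pair_unique (List.nodup_reverse.mpr hP) h1 h2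

open Classical in
theorem card_Z (hP : P.Nodup) : (univ.filter fun w => ZS R P t w).card ≤ 3 * (Sf R P t).card := by
  have h1 : (univ.filter fun w => ∃ y ∈ Sf R P t, [y, w] <:+: P).card ≤ (Sf R P t).card := by
    apply Finset.card_le_card_of_forall_subsingleton (fun w y => [y, w] <:+: P)
    · intro w hw; simpa using hw
    · intro y hy w hw w' hw'
      exact pair_unique hP hw.2 hw'.2
  have h2 : (univ.filter fun w => ∃ y ∈ Sf R P t, [w, y] <:+: P).card ≤ (Sf R P t).card := by
    apply Finset.card_le_card_of_forall_subsingleton (fun w y => [w, y] <:+: P)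
    · intro w hw; simpa using hw
    · intro y hy w hw w' hw'
      exact pair_unique' hP hw.2 hw'.2
  have h3 : (univ.filter fun w => ZS R P t w) ⊆ Sf R P t ∪
      ((univ.filter fun w => ∃ y ∈ Sf R P t, [y, w] <:+: P) ∪
       (univ.filter fun w => ∃ y ∈ Sf R P t, [w, y] <:+: P)) := by
    intro w hw
    simp only [mem_filter, mem_univ, true_and, mem_union, mem_Sf] at hw ⊢
    rcases hw with h | ⟨y, h, h' | h'⟩
    · exact Or.inl h
    · exact Or.inr (Or.inl ⟨y, h, h'⟩)
    · exact Or.inr (Or.inr ⟨y, h, h'⟩)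
  have h4 := card_le_card h3
  have h5 := card_union_le (Sf R P t) ((univ.filter fun w => ∃ y ∈ Sf R P t, [y, w] <:+: P) ∪
       (univ.filter fun w => ∃ y ∈ Sf R P t, [w, y] <:+: P))
  have h6 := card_union_le (univ.filter fun w => ∃ y ∈ Sf R P t, [y, w] <:+: P)
       (univ.filter fun w => ∃ y ∈ Sf R P t, [w, y] <:+: P)
  omega

theorem nbS_le (hR : R ≤ R') (hP : LongL R' P) :
    (nbS R (Sf R P t)).card ≤ 3 * (Sf R P (t + 1)).card := by
  classical
  refine le_trans (card_le_card ?_) (card_Z (R := R) (t := t + 1) hP.1.2)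
  intro w hw
  simp only [nbS, mem_filter, mem_univ, true_and, mem_Sf] at hw ⊢
  obtain ⟨x, ⟨Q, hQ⟩, hx⟩ := hw
  exact step_Z hQ hx (longest_nbr_mem hR hP hQ hx)

theorem Sf_mono : Sf R P t ⊆ Sf R P (t + 1) := by
  intro x hx
  rw [mem_Sf] at *; exact hx.succ

theorem Sf_nonempty (hP : P ≠ []) : (Sf R P t).Nonempty := by
  induction t with
  | zero =>
    rcases P with _ | ⟨x, P⟩
    · exact absurd rfl hP
    · exact ⟨x, mem_Sf.mpr ⟨P, Reach.base⟩⟩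
  | succ t ih => exact ih.mono Sf_mono

theorem growth (hR : R ≤ R') (hP : LongL R' P) (hne : P ≠ []) {s0 : ℝ}
    (hexp : ∀ A : Finset V, A.Nonempty → (A.card : ℝ) ≤ s0 → 6 * A.card ≤ (nbS R A).card)
    {T : ℕ} (hT : Fintype.card V < 2 ^ T) : s0 < (Sf R P T).card := by
  by_contra hcon
  push Not at hcon
  have hle : ∀ i ≤ T, ((Sf R P i).card : ℝ) ≤ s0 := by
    intro i hi
    refine le_trans ?_ hcon
    have : Sf R P i ⊆ Sf R P T :=
      (monotone_nat_of_le_succ (f := fun i => Sf R P i) (fun _ => Sf_mono)) hi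
    exact_mod_cast card_le_card this
  have : ∀ i ≤ T, 2 ^ i ≤ (Sf R P i).card := by
    intro i
    induction i with
    | zero => intro _; simpa using (Sf_nonempty (R := R) (t := 0) hne).card_pos
    | succ i ih =>
      intro hi
      have h1 := ih (by omega)
      have h2 := hexp _ (Sf_nonempty (t := i) hne) (hle i (by omega))
      have h3 := nbS_le (t := i) hR hP
      rw [pow_succ]; omega
  have h1 := this T le_rfl
  have h2 := card_le_univ (Sf R P T)
  omega

theorem intv (hPn : P.Nodup) {α β : ℝ} (hα : 0 ≤ α)
    (hU : ∀ A B : Finset V, (eG R A B : ℝ) ≤ α * A.card * B.card + β)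
    (J : List V) (hJ : J.Nodup) (D : Finset V) (Q : V → List V)
    (hD : ∀ x ∈ D, Reach R P t (x :: Q x) ∧ J <:+: x :: Q x) :
    (eG R D J.toFinset : ℝ) ≤ α * D.card * ((Sf R P (t + 1) ∩ J.toFinset).card + 1) + β := by
  classical
  set X := J.toFinset.filter (fun w => ∃ x ∈ D, R.Adj x w) with hX
  have h1 : eG R D J.toFinset ≤ eG R D X := by
    apply eG_mono_set
    intro x hx w hw hxw
    rw [hX, mem_filter]; exact ⟨hw, x, hx, hxw⟩
  have h2 : X.card ≤ (Sf R P (t + 1) ∩ J.toFinset).card + 1 := by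
    rcases J with _ | ⟨h, J⟩
    · simp [hX]
    have h3 : (X.erase h).card ≤ (Sf R P (t + 1) ∩ (h :: J).toFinset).card := by
      apply Finset.card_le_card_of_forall_subsingleton (fun w y => [y, w] <:+: h :: J)
      · intro w hw
        simp only [hX, mem_erase, mem_filter, List.mem_toFinset] at hw
        obtain ⟨hwh, hwJ, x, hx, hxw⟩ := hw
        have hwJ' : w ∈ J := by
          rcases List.mem_cons.mp hwJ with h | h
          · exact absurd h hwh
          · exact h
        obtain ⟨a, b, rfl⟩ := List.append_of_mem hwJ'
        obtain ⟨y, c, hc⟩ := rot_last (x := h) (a := a)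
        have hyw : [y, w] <:+: h :: (a ++ w :: b) := by
          refine ⟨c, b, ?_⟩
          rw [← List.cons_append, hc]; simp
        refine ⟨y, ?_, hyw⟩
        rw [mem_inter, mem_Sf, List.mem_toFinset]
        exact ⟨step_interval (hD x hx).1 hPn hxw (hD x hx).2 hyw, hyw.mem (by simp)⟩
      · intro y hy w hw w' hw'
        exact pair_unique hJ hw.2 hw'.2
    have := Finset.pred_card_le_card_erase (s := X) (a := h)
    omega
  have h3 := hU D X
  have h4 : (X.card : ℝ) ≤ (Sf R P (t + 1) ∩ J.toFinset).card + 1 := by exact_mod_cast h2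
  have h5 : (eG R D J.toFinset : ℝ) ≤ eG R D X := by exact_mod_cast h1
  have h6 : α * D.card * X.card ≤ α * D.card * ((Sf R P (t + 1) ∩ J.toFinset).card + 1) :=
    mul_le_mul_of_nonneg_left h4 (by positivity)
  linarith

theorem final_step (hR : R ≤ R') (hP : LongL R' P) {α β d : ℝ} (hα : 0 ≤ α)
    (hU : ∀ A B : Finset V, (eG R A B : ℝ) ≤ α * A.card * B.card + β)
    (hd : ∀ v, d ≤ (nb R v).card) {k L : ℕ} (hL : 0 < L) (hkL : Fintype.card V ≤ k * L) :
    d * (Sf R P t).card ≤ α * (Sf R P t).card * ((Sf R P (t + 1)).card + k + L * t)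
      + 3 * k * β := by
  classical
  set S := Sf R P t with hS
  set Y := Sf R P (t + 1) with hY
  have hPn := hP.1.2
  have hQ : ∀ x, ∃ Q, x ∈ S → Reach R P t (x :: Q) := by
    intro x
    by_cases hx : x ∈ S
    · obtain ⟨Q, h⟩ := mem_Sf.mp hx; exact ⟨Q, fun _ => h⟩
    · exact ⟨[], fun h => absurd h hx⟩
  choose Q hQ using hQ
  let I : ℕ → List V := fun i => (P.drop (i * L)).take L
  have hIP : ∀ i, I i <:+: P := fun i =>
    (List.take_prefix _ _).isInfix.trans (List.drop_suffix _ _).isInfix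
  have hIn : ∀ i, (I i).Nodup := fun i => hPn.sublist (hIP i).sublist
  have hIL : ∀ i, (I i).toFinset.card ≤ L := fun i =>
    (List.toFinset_card_le _).trans (by simp [I])
  have hlen : P.length ≤ k * L := (hPn.length_le_card).trans hkL
  have h1 : d * S.card ≤ ∑ i ∈ range k, (eG R S (I i).toFinset : ℝ) := by
    have h11 : ∀ x ∈ S, (nb R x).card ≤ ∑ i ∈ range k, (nb R x ∩ (I i).toFinset).card := by
      intro x hx
      refine le_trans (card_le_card ?_) card_biUnion_le
      intro w hw
      rw [mem_biUnion]
      have hwP : w ∈ P := longest_nbr_mem hR hP (hQ x hx) (mem_nb.mp hw)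
      refine ⟨P.idxOf w / L, ?_, ?_⟩
      · rw [mem_range, Nat.div_lt_iff_lt_mul hL]
        exact lt_of_lt_of_le (List.idxOf_lt_length_of_mem hwP) hlen
      · rw [mem_inter, List.mem_toFinset]; exact ⟨hw, mem_chunk hL hwP⟩
    calc d * S.card = ∑ x ∈ S, d := by rw [sum_const, nsmul_eq_mul, mul_comm]
      _ ≤ ∑ x ∈ S, ((nb R x).card : ℝ) := sum_le_sum fun x _ => hd x
      _ ≤ ∑ x ∈ S, ((∑ i ∈ range k, (nb R x ∩ (I i).toFinset).card : ℕ) : ℝ) :=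
          sum_le_sum fun x hx => by exact_mod_cast h11 x hx
      _ = ∑ i ∈ range k, (eG R S (I i).toFinset : ℝ) := by
          push_cast
          rw [sum_comm]
          refine sum_congr rfl fun i _ => ?_
          rw [eG_eq_sum]; push_cast; rfl
  let Dp : ℕ → Finset V := fun i => S.filter fun x => I i <:+: x :: Q x
  let Dm : ℕ → Finset V := fun i => S.filter fun x => ¬ (I i <:+: x :: Q x) ∧
    (I i).reverse <:+: x :: Q x
  let Db : ℕ → Finset V := fun i => S.filter fun x => ¬ Good P (x :: Q x) L i
  have h2 : ∀ i, eG R S (I i).toFinset ≤ eG R (Dp i) (I i).toFinset + eG R (Dm i) (I i).toFinset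
      + eG R (Db i) (I i).toFinset := by
    intro i
    rw [eG_eq_sum, eG_eq_sum, eG_eq_sum, eG_eq_sum, sum_filter, sum_filter, sum_filter,
      ← sum_add_distrib, ← sum_add_distrib]
    refine sum_le_sum fun x _ => ?_
    by_cases h : I i <:+: x :: Q x
    · simp [h]
    · by_cases h' : (I i).reverse <:+: x :: Q x
      · simp [h, h']
      · have : ¬ Good P (x :: Q x) L i := by
          rintro (h1 | h1)
          · exact h h1
          · exact h' h1
        simp [h, h', this]
  have h3 : ∀ i, ((Dp i).card : ℝ) + (Dm i).card ≤ S.card := by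
    intro i
    have : Disjoint (Dp i) (Dm i) := by
      rw [Finset.disjoint_left]
      intro x hx hx'
      simp only [Dp, Dm, mem_filter] at hx hx'
      exact hx'.2.1 hx.2
    have h := card_union_of_disjoint this
    have h' : Dp i ∪ Dm i ⊆ S := union_subset (filter_subset _ _) (filter_subset _ _)
    have := card_le_card h'
    exact_mod_cast h ▸ this
  have h4 : ∀ i, (eG R S (I i).toFinset : ℝ) ≤
      α * S.card * ((Y ∩ (I i).toFinset).card + 1) + α * L * (Db i).card + 3 * β := by
    intro i
    have hp := intv hPn hα hU (I i) (hIn i) (Dp i) Q (t := t) (by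
      intro x hx; simp only [Dp, mem_filter] at hx; exact ⟨hQ x hx.1, hx.2⟩)
    have hm := intv hPn hα hU (I i).reverse (List.nodup_reverse.mpr (hIn i)) (Dm i) Q (t := t) (by
      intro x hx; simp only [Dm, mem_filter] at hx; exact ⟨hQ x hx.1, hx.2.2⟩)
    rw [List.toFinset_reverse] at hm
    have hb := hU (Db i) (I i).toFinset
    have hb' : α * (Db i).card * (I i).toFinset.card ≤ α * (Db i).card * L :=
      mul_le_mul_of_nonneg_left (by exact_mod_cast hIL i) (by positivity)
    have h5 : (eG R S (I i).toFinset : ℝ) ≤ eG R (Dp i) (I i).toFinset +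
      eG R (Dm i) (I i).toFinset + eG R (Db i) (I i).toFinset := by exact_mod_cast h2 i
    rw [← hY] at hp hm
    have h6 : α * ((Y ∩ (I i).toFinset).card + 1) * (((Dp i).card : ℝ) + (Dm i).card) ≤
      α * ((Y ∩ (I i).toFinset).card + 1) * S.card :=
      mul_le_mul_of_nonneg_left (h3 i) (by positivity)
    nlinarith
  have h5 : ∑ i ∈ range k, ((Db i).card : ℝ) ≤ t * S.card := by
    have : ∑ i ∈ range k, (Db i).card ≤ t * S.card := by
      calc ∑ i ∈ range k, (Db i).card
          = ∑ x ∈ S, ((range k).filter fun i => ¬ Good P (x :: Q x) L i).card := by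
            simp only [Db, card_filter]
            rw [sum_comm]
        _ ≤ ∑ x ∈ S, t := sum_le_sum fun x hx => Reach.bad hPn hL k (hQ x hx)
        _ = t * S.card := by rw [sum_const, smul_eq_mul, mul_comm]
    exact_mod_cast this
  have h6 : ∑ i ∈ range k, ((Y ∩ (I i).toFinset).card : ℝ) ≤ Y.card := by
    have : ∑ i ∈ range k, (Y ∩ (I i).toFinset).card ≤ Y.card := by
      rw [← card_biUnion]
      · apply card_le_card
        intro x hx
        rw [mem_biUnion] at hx
        obtain ⟨i, _, hx⟩ := hx
        exact (mem_inter.mp hx).1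
      · intro i _ j _ hij
        rw [Function.onFun, Finset.disjoint_left]
        intro x hx hx'
        rw [mem_inter, List.mem_toFinset] at hx hx'
        apply hij
        rw [← chunk_idx hPn hL hx.2, ← chunk_idx hPn hL hx'.2]
    exact_mod_cast this
  have h7 : ∑ i ∈ range k, (eG R S (I i).toFinset : ℝ) ≤
      α * S.card * (∑ i ∈ range k, ((Y ∩ (I i).toFinset).card : ℝ) + k)
       + α * L * (∑ i ∈ range k, ((Db i).card : ℝ)) + 3 * k * β := by
    refine (sum_le_sum fun i _ => h4 i).trans (le_of_eq ?_)
    rw [sum_add_distrib, sum_add_distrib, ← mul_sum, ← mul_sum, sum_add_distrib]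
    simp; ring
  have h8 : α * S.card * (∑ i ∈ range k, ((Y ∩ (I i).toFinset).card : ℝ) + k) ≤
     α * S.card * (Y.card + k) := mul_le_mul_of_nonneg_left (by linarith) (by positivity)
  have h9 : α * L * (∑ i ∈ range k, ((Db i).card : ℝ)) ≤ α * L * (t * S.card) :=
    mul_le_mul_of_nonneg_left h5 (by positivity)
  nlinarith

/-- pairs of endpoints of longest paths -/
def Boost (R : SimpleGraph V) (u w : V) : Prop :=
  ∃ Q, LongL R Q ∧ Q.head? = some u ∧ Q.getLast? = some w

theorem LongL.reverse {Q : List V} (h : LongL R Q) : LongL R Q.reverse := by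
  refine ⟨⟨?_, List.nodup_reverse.mpr h.1.2⟩, by simpa using h.2⟩
  rw [List.isChain_reverse]
  refine h.1.1.imp ?_
  intro a b hab; exact hab.symm

theorem Boost.symm {u w : V} (h : Boost R u w) : Boost R w u := by
  obtain ⟨Q, h, h1, h2⟩ := h
  exact ⟨Q.reverse, h.reverse, by simpa using h2, by simpa using h1⟩

open Classical in
theorem boost_card (hR : R ≤ R') {α β d s0 : ℝ} (hα : 0 ≤ α) (hβ : 0 ≤ β) (hs0 : 0 < s0)
    (hexp : ∀ A : Finset V, A.Nonempty → (A.card : ℝ) ≤ s0 → 6 * A.card ≤ (nbS R A).card)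
    (hU : ∀ A B : Finset V, (eG R A B : ℝ) ≤ α * A.card * B.card + β)
    (hd : ∀ v, d ≤ (nb R v).card) {k L T : ℕ} (hL : 0 < L) (hkL : Fintype.card V ≤ k * L)
    (hT : Fintype.card V < 2 ^ T)
    (hnum : α * ((Fintype.card V : ℝ) / 2 + k + L * T) + 3 * k * β / s0 < d)
    {u w : V} (hb : Boost R' u w) :
    (Fintype.card V : ℝ) / 2 ≤ (univ.filter fun u => Boost R' u w).card := by
  obtain ⟨P, hP, hu, hw⟩ := hb
  have hne : P ≠ [] := by rintro rfl; simp at hu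
  have hg := growth hR hP hne hexp hT
  have hf := final_step (t := T) hR hP hα hU hd hL hkL
  have hsub : Sf R P (T + 1) ⊆ univ.filter fun u => Boost R' u w := by
    intro x hx
    obtain ⟨Q, hQ⟩ := mem_Sf.mp hx
    simp only [mem_filter, mem_univ, true_and]
    exact ⟨x :: Q, hQ.long hR hP, rfl, by rw [hQ.last, hw]⟩
  have hsub' : ((Sf R P (T + 1)).card : ℝ) ≤ (univ.filter fun u => Boost R' u w).card := by
    exact_mod_cast card_le_card hsub
  refine le_trans ?_ hsub'
  by_contra hcon
  push Not at hcon
  set s : ℝ := ((Sf R P T).card : ℝ)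
  have hs : 0 < s := hs0.trans hg
  have h1 : 3 * k * β ≤ s * (3 * k * β / s0) := by
    rw [mul_div_assoc', le_div_iff₀ hs0]
    nlinarith [mul_nonneg (mul_nonneg (by norm_num : (0:ℝ) ≤ 3) (Nat.cast_nonneg k)) hβ]
  have h2 : α * s * ((Sf R P (T + 1)).card + k + L * T) ≤
     α * s * ((Fintype.card V : ℝ) / 2 + k + L * T) :=
    mul_le_mul_of_nonneg_left (by linarith) (by positivity)
  nlinarith [mul_lt_mul_of_pos_left hnum hs]

end cnt
end partC

section partD
open Finset

section det
variable {V : Type*} [Fintype V] [DecidableEq V]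

open Classical in
noncomputable def Ef (R : SimpleGraph V) : Finset (Sym2 V) := univ.filter fun e => e ∈ R.edgeSet

theorem ham_of_list {G : SimpleGraph V} {P : List V} (hc : P.IsChain G.Adj) (hn : P.Nodup)
    (hall : ∀ v, v ∈ P) {u w : V} (hu : P.head? = some u) (hw : P.getLast? = some w)
    (hadj : G.Adj u w) (h3 : 3 ≤ Fintype.card V) : G.IsHamiltonian := by
  intro _
  have hne : P ≠ [] := by rintro rfl; simp at hu
  have hlen : P.length = Fintype.card V := by
    rw [← List.toFinset_card_of_nodup hn]
    rw [show P.toFinset = univ from by ext v; simp [hall]]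
    rfl
  have hu' : P.head hne = u := by
    rw [List.head?_eq_some_head hne] at hu; simpa using hu
  have hw' : P.getLast hne = w := by
    rw [List.getLast?_eq_some_getLast hne] at hw; simpa using hw
  let q := SimpleGraph.Walk.ofSupport P hne hc
  have hq : q.support = P := SimpleGraph.Walk.support_ofSupport hne hc
  have hql : q.length = P.length - 1 := SimpleGraph.Walk.length_ofSupport hne hc
  have hadj' : G.Adj (P.getLast hne) (P.head hne) := by rw [hu', hw']; exact hadj.symm
  refine ⟨_, SimpleGraph.Walk.cons hadj' q, ?_⟩
  rw [SimpleGraph.Walk.isHamiltonianCycle_iff_isCycle_and_length_eq,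
    SimpleGraph.Walk.isCycle_iff_isPath_tail_and_le_length]
  have hl : (SimpleGraph.Walk.cons hadj' q).length = Fintype.card V := by
    rw [SimpleGraph.Walk.length_cons, hql, hlen]; omega
  refine ⟨⟨?_, by rw [hl]; exact h3⟩, hl⟩
  have : q.IsPath := by rw [SimpleGraph.Walk.isPath_def, hq]; exact hn
  simpa using this

theorem longer {R R2 : SimpleGraph V} {Q : List V} (hc : Q.IsChain R2.Adj) (hn : Q.Nodup)
    (hR : R ≤ R2) {u w x z : V} (hu : Q.head? = some u) (hw : Q.getLast? = some w)
    (hadj : R2.Adj u w) (hx : x ∈ Q) (hz : z ∉ Q) (hxz : R.Adj x z) :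
    ∃ Q', PathL R2 Q' ∧ Q'.length = Q.length + 1 := by
  obtain ⟨a, b, rfl⟩ := List.append_of_mem hx
  have hp : (x :: b ++ a).Perm (a ++ x :: b) := List.perm_append_comm
  refine ⟨z :: (x :: b ++ a), ⟨?_, ?_⟩, ?_⟩
  · rw [List.isChain_append] at hc
    rw [List.cons_append, List.isChain_cons_cons, ← List.cons_append]
    refine ⟨(hR hxz).symm, ?_⟩
    rw [List.isChain_append]
    refine ⟨hc.2.1, hc.1, ?_⟩
    intro s hs t ht
    have h1 : s = w := by
      rw [List.getLast?_append] at hw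
      have hs' : (x :: b).getLast? = some s := hs
      rw [hs'] at hw; simpa using hw
    have h2 : t = u := by
      rw [List.head?_append] at hu
      have ht' : a.head? = some t := ht
      rw [ht'] at hu; simpa using hu
    subst h1 h2
    exact hadj.symm
  · rw [List.nodup_cons]
    exact ⟨fun h => hz (hp.mem_iff.mp h), hp.nodup_iff.mpr hn⟩
  · simp; omega

theorem closed_false {R : SimpleGraph V} {α β d s0 : ℝ} (hα : 0 ≤ α) (hβ : 0 ≤ β) (hs0 : 0 < s0)
    (hexp : ∀ A : Finset V, A.Nonempty → (A.card : ℝ) ≤ s0 → 6 * A.card ≤ (nbS R A).card)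
    (hU : ∀ A B : Finset V, (eG R A B : ℝ) ≤ α * A.card * B.card + β)
    (hd : ∀ v, d ≤ (nb R v).card)
    (hnum : α * ((Fintype.card V : ℝ) / 2) + β / s0 < d)
    (A : Finset V) (hA : A.Nonempty) (hA2 : (A.card : ℝ) ≤ Fintype.card V / 2)
    (hcl : ∀ x ∈ A, ∀ w, R.Adj x w → w ∈ A) : False := by
  have hApos : (0:ℝ) < A.card := by exact_mod_cast hA.card_pos
  by_cases h : (A.card : ℝ) ≤ s0
  · have h1 := hexp A hA h
    have h2 : nbS R A ⊆ A := by
      intro w hw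
      simp only [nbS, mem_filter, mem_univ, true_and] at hw
      obtain ⟨x, hx, hxw⟩ := hw
      exact hcl x hx w hxw
    have h3 := card_le_card h2
    have := hA.card_pos
    omega
  · push Not at h
    have h1 : d * A.card ≤ eG R A A := by
      rw [eG_eq_sum]
      push_cast
      calc d * A.card = ∑ x ∈ A, d := by rw [sum_const, nsmul_eq_mul, mul_comm]
        _ ≤ ∑ x ∈ A, ((nb R x ∩ A).card : ℝ) := by
          refine sum_le_sum fun x hx => ?_
          rw [inter_eq_left.mpr]
          · exact hd x
          · intro w hw; exact hcl x hx w (mem_nb.mp hw)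
    have h2 := hU A A
    have h3 : β ≤ A.card * (β / s0) := by
      rw [mul_div_assoc', le_div_iff₀ hs0]; nlinarith
    have h4 : α * A.card * A.card ≤ α * A.card * (Fintype.card V / 2) :=
      mul_le_mul_of_nonneg_left hA2 (by positivity)
    nlinarith [mul_lt_mul_of_pos_left hnum hApos]

theorem conn_of {R : SimpleGraph V} {α β d s0 : ℝ} (hα : 0 ≤ α) (hβ : 0 ≤ β) (hs0 : 0 < s0)
    (hexp : ∀ A : Finset V, A.Nonempty → (A.card : ℝ) ≤ s0 → 6 * A.card ≤ (nbS R A).card)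
    (hU : ∀ A B : Finset V, (eG R A B : ℝ) ≤ α * A.card * B.card + β)
    (hd : ∀ v, d ≤ (nb R v).card)
    (hnum : α * ((Fintype.card V : ℝ) / 2) + β / s0 < d)
    (A : Finset V) (hA : A.Nonempty) (hA2 : A ≠ univ) : ∃ x ∈ A, ∃ w, w ∉ A ∧ R.Adj x w := by
  by_contra hcon
  push Not at hcon
  have hcl : ∀ x ∈ A, ∀ w, R.Adj x w → w ∈ A := by
    intro x hx w hxw
    by_contra h
    exact hcon x hx w h hxw
  have hcl' : ∀ x ∈ Aᶜ, ∀ w, R.Adj x w → w ∈ Aᶜ := by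
    intro x hx w hxw
    rw [mem_compl] at hx ⊢
    exact fun h => hx (hcl w h x hxw.symm)
  have hsum : (A.card : ℝ) + Aᶜ.card = Fintype.card V := by exact_mod_cast card_add_card_compl A
  by_cases h : (A.card : ℝ) ≤ Fintype.card V / 2
  · exact closed_false hα hβ hs0 hexp hU hd hnum A hA h hcl
  · refine closed_false hα hβ hs0 hexp hU hd hnum Aᶜ ?_ (by linarith) hcl'
    rw [nonempty_iff_ne_empty]
    intro h; exact hA2 (compl_eq_empty_iff _ |>.mp h)

theorem ham_of_boost {R G : SimpleGraph V} (hRG : R ≤ G) (h3 : 3 ≤ Fintype.card V)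
    (hconn : ∀ A : Finset V, A.Nonempty → A ≠ univ → ∃ x ∈ A, ∃ w, w ∉ A ∧ R.Adj x w)
    (hboost : ∀ R' : SimpleGraph V, R ≤ R' → R' ≤ G → (Ef R').card ≤ (Ef R).card + Fintype.card V →
      ∃ u w, Boost R' u w ∧ G.Adj u w) : G.IsHamiltonian := by
  classical
  let p : ℕ → Prop := fun m => ∃ (R' : SimpleGraph V) (P : List V), R ≤ R' ∧ R' ≤ G ∧
    PathL R' P ∧ P.length = m ∧ (Ef R').card ≤ (Ef R).card + m
  have hbd : ∀ m, p m → m ≤ Fintype.card V := by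
    rintro m ⟨R', P, _, _, hP, rfl, _⟩
    exact hP.2.length_le_card
  have h0 : p 0 := ⟨R, [], le_rfl, hRG, ⟨by simp, by simp⟩, rfl, by simp⟩
  set m := Nat.findGreatest p (Fintype.card V) with hm
  have hpm : p m := Nat.findGreatest_spec (P := p) (Nat.zero_le _) h0
  have hmax : ∀ m', p m' → m' ≤ m := fun m' h => Nat.le_findGreatest (hbd m' h) h
  obtain ⟨R', P, h1, h2, hP, hPm, hE⟩ := id hpm
  have hall : ∀ Q, PathL R' Q → Q.length ≤ m := by
    intro Q hQ
    by_contra hcon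
    push Not at hcon
    have := hmax Q.length ⟨R', Q, h1, h2, hQ, rfl, by omega⟩
    omega
  obtain ⟨u, w, ⟨Q, hQ, hu, hw⟩, huw⟩ := hboost R' h1 h2 (by have := hbd m hpm; omega)
  have hQm : Q.length = m := le_antisymm (hall Q hQ.1) (hPm ▸ hQ.2 P hP)
  let R2 := R' ⊔ SimpleGraph.edge u w
  have hR2 : R2 ≤ G := sup_le h2 (by
    rw [SimpleGraph.edge_le_iff]; exact Or.inr huw)
  have hadj : R2.Adj u w := by
    right; rw [SimpleGraph.edge_adj]; exact ⟨Or.inl ⟨rfl, rfl⟩, huw.ne⟩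
  have hc2 : Q.IsChain R2.Adj := hQ.1.1.imp fun a b hab => Or.inl hab
  by_cases hsp : ∀ v, v ∈ Q
  · exact (ham_of_list hc2 hQ.1.2 hsp hu hw hadj h3).mono hR2
  · exfalso
    push Not at hsp
    obtain ⟨v, hv⟩ := hsp
    obtain ⟨x, hx, z, hz, hxz⟩ := hconn Q.toFinset (by
      refine ⟨u, ?_⟩
      rw [List.mem_toFinset]
      exact List.mem_of_mem_head? hu) (by
      intro h
      have := mem_univ v
      rw [← h, List.mem_toFinset] at this
      exact hv this)
    rw [List.mem_toFinset] at hx hz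
    obtain ⟨Q', hQ', hl⟩ := longer hc2 hQ.1.2 (h1.trans le_sup_left) hu hw hadj hx hz hxz
    have hE2 : (Ef R2).card ≤ (Ef R').card + 1 := by
      refine le_trans (card_le_card (t := insert s(u, w) (Ef R')) ?_) (card_insert_le _ _)
      intro e he
      simp only [Ef, mem_filter, mem_univ, true_and, mem_insert] at he ⊢
      induction e with | h a b
      rw [SimpleGraph.mem_edgeSet] at he ⊢
      rcases he with he | he
      · exact Or.inr he
      · rw [SimpleGraph.edge_adj] at he
        left
        rcases he.1 with ⟨rfl, rfl⟩ | ⟨rfl, rfl⟩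
        · rfl
        · exact Sym2.eq_swap
    have := hmax Q'.length ⟨R2, Q', h1.trans le_sup_left, hR2, hQ', rfl, by omega⟩
    omega

end det
end partD

section partA
open Finset

section prob
variable {E : Type*} [Fintype E] [DecidableEq E]

/-- weight of an outcome -/
noncomputable def Wt (p : ℝ) (ω : E → Bool) : ℝ := ∏ e, if ω e = true then p else 1 - p

open Classical in
/-- probability of an event -/
noncomputable def Pr (p : ℝ) (A : Set (E → Bool)) : ℝ := ∑ ω, if ω ∈ A then Wt p ω else 0

theorem Wt_nonneg {p : ℝ} (h0 : 0 ≤ p) (h1 : p ≤ 1) (ω : E → Bool) : 0 ≤ Wt p ω := by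
  unfold Wt
  refine prod_nonneg fun e _ => ?_
  split_ifs <;> linarith

theorem sum_prod_bool (g : E → Bool → ℝ) :
    ∑ ω : E → Bool, ∏ e, g e (ω e) = ∏ e, (g e true + g e false) := by
  have := Finset.prod_univ_sum (fun _ : E => (univ : Finset Bool)) g
  simp only [Fintype.univ_bool, Fintype.piFinset_univ] at this
  rw [← Fintype.univ_bool] at this
  simp only [Fintype.piFinset_univ] at this
  rw [← this]
  simp

theorem Pr_univ (p : ℝ) : Pr p (Set.univ : Set (E → Bool)) = 1 := by
  unfold Pr
  simp only [Set.mem_univ, if_true]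
  unfold Wt
  rw [sum_prod_bool (fun _ b => if b = true then p else 1 - p)]
  simp

theorem Pr_nonneg {p : ℝ} (h0 : 0 ≤ p) (h1 : p ≤ 1) (A : Set (E → Bool)) : 0 ≤ Pr p A := by
  unfold Pr
  refine sum_nonneg fun ω _ => ?_
  split_ifs
  · exact Wt_nonneg h0 h1 ω
  · exact le_rfl

theorem Pr_mono {p : ℝ} (h0 : 0 ≤ p) (h1 : p ≤ 1) {A B : Set (E → Bool)} (h : A ⊆ B) :
    Pr p A ≤ Pr p B := by
  unfold Pr
  refine sum_le_sum fun ω _ => ?_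
  by_cases hA : ω ∈ A
  · simp [hA, h hA]
  · simp only [hA, if_false]
    split_ifs
    · exact Wt_nonneg h0 h1 ω
    · exact le_rfl

theorem Pr_union {p : ℝ} (h0 : 0 ≤ p) (h1 : p ≤ 1) (A B : Set (E → Bool)) :
    Pr p (A ∪ B) ≤ Pr p A + Pr p B := by
  unfold Pr
  rw [← sum_add_distrib]
  refine sum_le_sum fun ω _ => ?_
  have := Wt_nonneg h0 h1 ω
  by_cases hA : ω ∈ A <;> by_cases hB : ω ∈ B <;> simp [hA, hB, this]

theorem Pr_compl (p : ℝ) (A : Set (E → Bool)) : Pr p A + Pr p Aᶜ = 1 := by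
  rw [← Pr_univ (E := E) p]
  unfold Pr
  rw [← sum_add_distrib]
  refine sum_congr rfl fun ω _ => ?_
  by_cases hA : ω ∈ A <;> simp [hA]

theorem Pr_biUnion {p : ℝ} (h0 : 0 ≤ p) (h1 : p ≤ 1) {ι : Type*} (s : Finset ι)
    (A : ι → Set (E → Bool)) : Pr p {ω | ∃ i ∈ s, ω ∈ A i} ≤ ∑ i ∈ s, Pr p (A i) := by
  classical
  induction s using Finset.induction_on with
  | empty => simp [Pr]
  | insert i s hi ih =>
    rw [sum_insert hi]
    refine le_trans (Pr_mono h0 h1 ?_) (le_trans (Pr_union h0 h1 (A i) {ω | ∃ i ∈ s, ω ∈ A i}) (by linarith))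
    intro ω hω
    simpa using hω

theorem Pr_markov {p : ℝ} (h0 : 0 ≤ p) (h1 : p ≤ 1) (A : Set (E → Bool)) (f : (E → Bool) → ℝ)
    (hf : ∀ ω, 0 ≤ f ω) (hA : ∀ ω ∈ A, 1 ≤ f ω) : Pr p A ≤ ∑ ω, Wt p ω * f ω := by
  unfold Pr
  refine sum_le_sum fun ω _ => ?_
  have := Wt_nonneg h0 h1 ω
  split_ifs with h
  · nlinarith [hA ω h]
  · exact mul_nonneg this (hf ω)

/-- weighted count -/
noncomputable def Xc (m : E → ℝ) (ω : E → Bool) : ℝ := ∑ e, if ω e = true then m e else 0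

theorem exp_bd {x : ℝ} (hx : |x| ≤ 1) : Real.exp x ≤ 1 + x + x ^ 2 := by
  have := (abs_le.mp (Real.abs_exp_sub_one_sub_id_le hx)).2
  linarith

theorem Pr_upper {p ε t : ℝ} (h0 : 0 ≤ p) (h1 : p ≤ 1) (he : 0 < ε) (he1 : ε ≤ 1) (m : E → ℝ)
    (hm0 : ∀ e, 0 ≤ m e) (hm2 : ∀ e, m e ≤ 2) :
    Pr p {ω | (1 + ε) * p * ∑ e, m e + t ≤ Xc m ω} ≤ Real.exp (-(ε / 2) * t) := by
  set S := (1 + ε) * p * ∑ e, m e + t with hS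
  refine (Pr_markov h0 h1 _ (fun ω => Real.exp (ε / 2 * Xc m ω) * Real.exp (-(ε / 2 * S)))
    (fun ω => by positivity) ?_).trans ?_
  · intro ω hω
    rw [← Real.exp_add]
    apply Real.one_le_exp
    have : S ≤ Xc m ω := hω
    nlinarith
  · have h2 : ∑ ω, Wt p ω * (Real.exp (ε / 2 * Xc m ω) * Real.exp (-(ε / 2 * S)))
        = (∏ e, (p * Real.exp (ε / 2 * m e) + (1 - p))) * Real.exp (-(ε / 2 * S)) := by
      have := sum_prod_bool (E := E) fun e b => if b = true then p * Real.exp (ε / 2 * m e) else 1 - p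
      simp only [if_true, Bool.false_eq_true, if_false] at this
      rw [← this, sum_mul]
      refine sum_congr rfl fun ω _ => ?_
      rw [← mul_assoc]
      congr 1
      unfold Wt Xc
      rw [mul_sum, Real.exp_sum, ← prod_mul_distrib]
      refine prod_congr rfl fun e _ => ?_
      split_ifs <;> simp
    rw [h2]
    have h3 : ∏ e, (p * Real.exp (ε / 2 * m e) + (1 - p)) ≤
        ∏ e, Real.exp (ε / 2 * ((1 + ε) * p * m e)) := by
      refine prod_le_prod (fun e _ => ?_) fun e _ => ?_
      · have := Real.exp_pos (ε / 2 * m e); nlinarith [mul_nonneg h0 this.le]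
      · have hb : |ε / 2 * m e| ≤ 1 := by
          rw [abs_of_nonneg (mul_nonneg (by linarith) (hm0 e))]
          nlinarith [hm0 e, hm2 e]
        have h4 := exp_bd hb
        have h5 := Real.add_one_le_exp (ε / 2 * ((1 + ε) * p * m e))
        have h6 : (ε / 2 * m e) ^ 2 ≤ ε / 2 * m e * ε := by
          nlinarith [hm0 e, hm2 e, mul_nonneg (mul_nonneg (sq_nonneg ε) (hm0 e)) (sub_nonneg.mpr (hm2 e))]
        nlinarith
    rw [← Real.exp_sum, ← mul_sum, ← mul_sum] at h3
    refine (mul_le_mul_of_nonneg_right h3 (Real.exp_pos _).le).trans ?_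
    rw [← Real.exp_add]
    apply Real.exp_le_exp.mpr
    rw [hS]; ring_nf; exact le_rfl

theorem Pr_lower {p ε t : ℝ} (h0 : 0 ≤ p) (h1 : p ≤ 1) (he : 0 < ε) (he1 : ε ≤ 1) (m : E → ℝ)
    (hm0 : ∀ e, 0 ≤ m e) (hm2 : ∀ e, m e ≤ 2) (R : Finset E) (hR : ∀ e ∈ R, m e = 0) :
    Pr p {ω | (∀ e ∈ R, ω e = true) ∧ Xc m ω ≤ (1 - ε) * p * ∑ e, m e - t} ≤
      p ^ R.card * Real.exp (-(ε / 2) * t) := by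
  set S := (1 - ε) * p * ∑ e, m e - t with hS
  refine (Pr_markov h0 h1 _ (fun ω => (∏ e, if e ∈ R ∧ ω e = false then (0:ℝ) else 1) * Real.exp (-(ε / 2 * Xc m ω)) * Real.exp ((ε / 2 * S)))
    (fun ω => ?_) ?_).trans ?_
  · have : 0 ≤ (∏ e, if e ∈ R ∧ ω e = false then (0:ℝ) else 1) :=
      prod_nonneg fun e _ => by split_ifs <;> norm_num
    positivity
  · rintro ω ⟨hω1, hω2⟩
    rw [prod_eq_one, one_mul, ← Real.exp_add]
    · apply Real.one_le_exp
      nlinarith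
    · intro e _
      rw [if_neg]
      rintro ⟨h, h'⟩
      rw [hω1 e h] at h'; cases h'
  · have h2 : ∑ ω, Wt p ω * ((∏ e, if e ∈ R ∧ ω e = false then (0:ℝ) else 1) * Real.exp (-(ε / 2 * Xc m ω)) * Real.exp ((ε / 2 * S)))
        = (∏ e, (p * Real.exp (-(ε / 2 * m e)) + (if e ∈ R then 0 else 1 - p))) * Real.exp ((ε / 2 * S)) := by
      have := sum_prod_bool (E := E) fun e b => if b = true then p * Real.exp (-(ε / 2 * m e)) else (if e ∈ R then 0 else 1 - p)
      simp only [if_true, Bool.false_eq_true, if_false] at this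
      rw [← this, sum_mul]
      refine sum_congr rfl fun ω _ => ?_
      rw [← mul_assoc]
      congr 1
      unfold Wt Xc
      rw [mul_sum, ← sum_neg_distrib, Real.exp_sum, ← prod_mul_distrib, ← prod_mul_distrib]
      refine prod_congr rfl fun e _ => ?_
      by_cases hb : ω e = true
      · simp [hb]
      · have hb' : ω e = false := by simpa using hb
        by_cases hR : e ∈ R <;> simp [hb', hR]
    rw [h2]
    have h3 : ∏ e, (p * Real.exp (-(ε / 2 * m e)) + (if e ∈ R then 0 else 1 - p)) ≤
        ∏ e, ((if e ∈ R then p else 1) * Real.exp (-(ε / 2 * ((1 - ε) * p * m e)))) := by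
      refine prod_le_prod (fun e _ => ?_) fun e _ => ?_
      · have := Real.exp_pos (-(ε / 2 * m e))
        split_ifs
        · positivity
        · nlinarith [mul_nonneg h0 this.le]
      · by_cases heR : e ∈ R
        · simp [heR, hR e heR]
        · simp only [heR, if_false, one_mul]
          have hb : |-(ε / 2 * m e)| ≤ 1 := by
            rw [abs_neg, abs_of_nonneg (mul_nonneg (by linarith) (hm0 e))]
            nlinarith [hm0 e, hm2 e]
          have h4 := exp_bd hb
          have h5 := Real.add_one_le_exp (-(ε / 2 * ((1 - ε) * p * m e)))
          have h6 : (-(ε / 2 * m e)) ^ 2 ≤ ε / 2 * m e * ε := by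
            nlinarith [hm0 e, hm2 e, mul_nonneg (mul_nonneg (sq_nonneg ε) (hm0 e)) (sub_nonneg.mpr (hm2 e))]
          nlinarith
    rw [prod_mul_distrib, ← Real.exp_sum, sum_neg_distrib, ← mul_sum, ← mul_sum] at h3
    have h7 : (∏ e, if e ∈ R then p else (1:ℝ)) = p ^ R.card := by
      rw [prod_ite_mem, univ_inter, prod_const]
    rw [h7] at h3
    refine (mul_le_mul_of_nonneg_right h3 (Real.exp_pos _).le).trans ?_
    rw [mul_assoc, ← Real.exp_add]
    apply mul_le_mul_of_nonneg_left _ (by positivity)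
    apply Real.exp_le_exp.mpr
    rw [hS]; ring_nf; exact le_rfl

/-- generating function bound for summing over small edge sets -/
theorem sum_pow_small {p y M : ℝ} (h0 : 0 ≤ p) (hy : 0 ≤ y) :
    ∑ R ∈ (univ : Finset (Finset E)).filter (fun R => (R.card : ℝ) ≤ M), p ^ R.card ≤
      Real.exp (y * M + p * Real.exp (-y) * Fintype.card E) := by
  have h1 : ∑ R ∈ (univ : Finset (Finset E)).filter (fun R => (R.card : ℝ) ≤ M), p ^ R.card ≤
      ∑ R : Finset E, Real.exp (y * M) * (p * Real.exp (-y)) ^ R.card := by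
    refine (sum_le_sum fun R hR => ?_).trans
      (sum_le_sum_of_subset_of_nonneg (filter_subset _ _) fun R _ _ => by positivity)
    have hM : (R.card : ℝ) ≤ M := by simpa using hR
    rw [mul_pow, ← Real.exp_nat_mul, mul_left_comm, ← Real.exp_add]
    have : 1 ≤ Real.exp (y * M + R.card * -y) := Real.one_le_exp (by nlinarith)
    nlinarith [pow_nonneg h0 R.card]
  refine h1.trans ?_
  rw [← mul_sum, Real.exp_add]
  apply mul_le_mul_of_nonneg_left _ (Real.exp_pos _).le
  have h2 := Finset.prod_add_one (f := fun _ : E => p * Real.exp (-y)) (s := univ)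
  simp only [prod_const, powerset_univ] at h2
  rw [← h2]
  have h3 := Real.add_one_le_exp (p * Real.exp (-y))
  calc _ ≤ (Real.exp (p * Real.exp (-y))) ^ (univ : Finset E).card :=
        pow_le_pow_left₀ (by positivity) h3 _
    _ = _ := by rw [← Real.exp_nat_mul, card_univ, mul_comm]
end prob

section pairs
variable {V : Type*} [Fintype V] [DecidableEq V]

/-- multiplicity -/
noncomputable def mu (Ps : Finset (V × V)) (e : Sym2 V) : ℝ :=
  ((Ps.filter fun x => s(x.1, x.2) = e).card : ℝ)

theorem mu_nonneg (Ps : Finset (V × V)) (e : Sym2 V) : 0 ≤ mu Ps e := by unfold mu; positivity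

theorem mu_le (Ps : Finset (V × V)) (e : Sym2 V) : mu Ps e ≤ 2 := by
  unfold mu
  induction e using Sym2.ind with
  | _ a b =>
    have : (Ps.filter fun x => s(x.1, x.2) = s(a, b)) ⊆ {(a, b), (b, a)} := by
      rintro ⟨x, y⟩ h
      simpa [Sym2.eq_iff] using (mem_filter.mp h).2
    exact_mod_cast (card_le_card this).trans card_le_two

theorem sum_mu (Ps : Finset (V × V)) : ∑ e, mu Ps e = (Ps.card : ℝ) := by
  unfold mu
  rw [card_eq_sum_card_fiberwise (f := fun x : V × V => s(x.1, x.2)) (t := univ) (by simp)]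
  push_cast; rfl

theorem Xc_mu (Ps : Finset (V × V)) (ω : Sym2 V → Bool) :
    Xc (mu Ps) ω = ((Ps.filter fun x => ω s(x.1, x.2) = true).card : ℝ) := by
  unfold Xc
  rw [← sum_filter]
  unfold mu
  rw [card_eq_sum_card_fiberwise (s := Ps.filter fun x => ω s(x.1, x.2) = true)
    (f := fun x : V × V => s(x.1, x.2)) (t := univ.filter fun e => ω e = true)]
  · push_cast
    refine sum_congr rfl fun e he => ?_
    congr 2
    ext x
    simp only [mem_filter, mem_univ, true_and] at *
    constructor
    · rintro ⟨h1, h2⟩; exact ⟨⟨h1, h2 ▸ he⟩, h2⟩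
    · rintro ⟨⟨h1, _⟩, h2⟩; exact ⟨h1, h2⟩
  · intro x hx; simpa using (mem_filter.mp hx).2

theorem pairs_upper {p ε t : ℝ} (h0 : 0 ≤ p) (h1 : p ≤ 1) (he : 0 < ε) (he1 : ε ≤ 1)
    (Ps : Finset (V × V)) :
    Pr p {ω | (1 + ε) * p * Ps.card + t ≤ ((Ps.filter fun x => ω s(x.1, x.2) = true).card : ℝ)}
      ≤ Real.exp (-(ε / 2) * t) := by
  have := Pr_upper (t := t) h0 h1 he he1 (mu Ps) (mu_nonneg Ps) (mu_le Ps)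
  simpa only [sum_mu, Xc_mu] using this

theorem pairs_lower {p ε t : ℝ} (h0 : 0 ≤ p) (h1 : p ≤ 1) (he : 0 < ε) (he1 : ε ≤ 1)
    (Ps : Finset (V × V)) (R : Finset (Sym2 V)) (hR : ∀ x ∈ Ps, s(x.1, x.2) ∉ R) :
    Pr p {ω | (∀ e ∈ R, ω e = true) ∧
      ((Ps.filter fun x => ω s(x.1, x.2) = true).card : ℝ) ≤ (1 - ε) * p * Ps.card - t}
      ≤ p ^ R.card * Real.exp (-(ε / 2) * t) := by
  have := Pr_lower (t := t) h0 h1 he he1 (mu Ps) (mu_nonneg Ps) (mu_le Ps) R (by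
    intro e heR
    unfold mu
    rw [Nat.cast_eq_zero, card_eq_zero, filter_eq_empty_iff]
    rintro x hx rfl
    exact hR x hx heR)
  simpa only [sum_mu, Xc_mu] using this
end pairs
end partA

section partF
open Finset

section fin
variable {V : Type*} [Fintype V] [DecidableEq V]

open Classical in
/-- pairs of endpoints of longest paths -/
noncomputable def BF (R : SimpleGraph V) : Finset (V × V) := univ.filter fun x => Boost R x.1 x.2

open Classical in
theorem exists_boost (R : SimpleGraph V) (v : V) : ∃ u w, Boost R u w := by
  let p : ℕ → Prop := fun m => ∃ P : List V, PathL R P ∧ P.length = m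
  have hbd : ∀ m, p m → m ≤ Fintype.card V := by
    rintro m ⟨P, hP, rfl⟩
    exact hP.2.length_le_card
  have h1 : p 1 := ⟨[v], ⟨by simp, by simp⟩, rfl⟩
  obtain ⟨P, hP, hm⟩ : p (Nat.findGreatest p (Fintype.card V)) :=
    Nat.findGreatest_spec (P := p) (hbd 1 h1) h1
  have hmax : ∀ m', p m' → m' ≤ P.length := fun m' h => hm ▸ Nat.le_findGreatest (hbd m' h) h
  have hne : P ≠ [] := by
    rintro rfl
    have := hmax 1 h1
    simp at this
  exact ⟨P.head hne, P.getLast hne, P, ⟨hP, fun Q hQ => hmax _ ⟨Q, hQ, rfl⟩⟩,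
    List.head?_eq_some_head hne, List.getLast?_eq_some_getLast hne⟩

open Classical in
theorem det_main {Γ G R : SimpleGraph V} {α β d s0 p ε γ M : ℝ} {k L T : ℕ}
    (hp : 0 < p) (hε : 0 < ε) (hγ : 16 * ε ≤ γ) (hγ4 : γ ≤ 1 / 4)
    (h3 : 3 ≤ Fintype.card V)
    (hG : ∀ v, ((nb Γ v \ nb G v).card : ℝ) ≤ (1 / 2 - γ) * (nb Γ v).card)
    (hdeg : ∀ v, ((nb Γ v).card : ℝ) ≤ (1 + 2 * ε) * p * Fintype.card V)
    (hE2 : ∀ R' : SimpleGraph V, R' ≤ Γ → ((Ef R').card : ℝ) ≤ M →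
      (Fintype.card V : ℝ) ^ 2 / 4 ≤ (BF R').card →
      (1 - 3 * ε) * p * (BF R').card ≤ (((BF R').filter fun x => Γ.Adj x.1 x.2).card : ℝ))
    (hGΓ : G ≤ Γ) (hRG : R ≤ G)
    (hM : ((Ef R).card : ℝ) + Fintype.card V ≤ M)
    (hα : 0 ≤ α) (hβ : 0 ≤ β) (hs0 : 0 < s0)
    (hexp : ∀ A : Finset V, A.Nonempty → (A.card : ℝ) ≤ s0 → 6 * A.card ≤ (nbS R A).card)
    (hU : ∀ A B : Finset V, (eG R A B : ℝ) ≤ α * A.card * B.card + β)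
    (hd : ∀ v, d ≤ (nb R v).card) (hL : 0 < L) (hk : 0 < k) (hkL : Fintype.card V ≤ k * L)
    (hT : Fintype.card V < 2 ^ T)
    (hnum : α * ((Fintype.card V : ℝ) / 2 + k + L * T) + 3 * k * β / s0 < d) :
    G.IsHamiltonian := by
  have hkR : (1 : ℝ) ≤ k := by exact_mod_cast hk
  have hconn := conn_of (R := R) hα hβ hs0 hexp hU hd (by
    refine lt_of_le_of_lt (add_le_add ?_ ?_) hnum
    · apply mul_le_mul_of_nonneg_left _ hα
      have : (0 : ℝ) ≤ (L : ℝ) * T := by positivity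
      linarith
    · apply div_le_div_of_nonneg_right _ hs0.le
      nlinarith)
  refine ham_of_boost hRG h3 hconn fun R' h1 h2 hc => ?_
  by_contra hcon
  push Not at hcon
  set n : ℝ := ((Fintype.card V : ℕ) : ℝ) with hn
  have hn3 : (3 : ℝ) ≤ n := by rw [hn]; exact_mod_cast h3
  have hbc : ∀ {u w}, Boost R' u w → n / 2 ≤ ((univ.filter fun w' => Boost R' u w').card : ℝ) := by
    intro u w hb
    have := boost_card h1 hα hβ hs0 hexp hU hd hL hkL hT hnum hb.symm
    refine this.trans (le_of_eq ?_)
    congr 2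
    ext x; simp only [mem_filter, mem_univ, true_and]
    exact ⟨fun h => h.symm, fun h => h.symm⟩
  set S : Finset V := univ.filter fun u => ∃ w, Boost R' u w with hS
  have hcard : ∀ (q : V × V → Prop), ((((BF R').filter q).card : ℕ) : ℝ) =
      ∑ u ∈ S, ((univ.filter fun w => Boost R' u w ∧ q (u, w)).card : ℝ) := by
    intro q
    rw [card_eq_sum_card_fiberwise (f := fun x : V × V => x.1) (t := S)]
    · push_cast
      refine sum_congr rfl fun u _ => ?_
      congr 1
      symm
      refine card_bij (fun w _ => (u, w)) ?_ ?_ ?_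
      · intro w hw
        simpa [BF] using hw
      · intro a _ b _ h; simpa using h
      · rintro ⟨a, b⟩ hab
        simp only [BF, mem_filter, mem_univ, true_and] at hab
        obtain ⟨⟨h, h'⟩, rfl⟩ := hab
        exact ⟨b, by simp [h, h'], rfl⟩
    · rintro ⟨a, b⟩ hab
      simp only [BF, coe_filter, mem_filter, mem_univ, true_and, Set.mem_setOf_eq] at hab
      simp only [hS, coe_filter, mem_univ, true_and, Set.mem_setOf_eq]
      exact ⟨b, hab.1⟩
  have hF : (S.card : ℝ) * (n / 2) ≤ (BF R').card := by
    have := hcard fun _ => True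
    simp only [filter_true, and_true] at this
    rw [this, ← nsmul_eq_mul]
    refine card_nsmul_le_sum _ _ _ fun u hu => ?_
    obtain ⟨w, hw⟩ := (mem_filter.mp hu).2
    exact hbc hw
  have hSn : n / 2 ≤ S.card := by
    obtain ⟨v⟩ : Nonempty V := Fintype.card_pos_iff.mp (by omega)
    obtain ⟨u, w, hb⟩ := exists_boost R' v
    refine (hbc hb).trans ?_
    have : (univ.filter fun w' => Boost R' u w') ⊆ S := by
      intro x hx
      rw [hS]
      simp only [mem_filter, mem_univ, true_and] at hx ⊢
      exact ⟨u, hx.symm⟩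
    exact_mod_cast card_le_card this
  have hlow := hE2 R' (h2.trans hGΓ) (by
    have : ((Ef R').card : ℝ) ≤ (Ef R).card + n := by rw [hn]; exact_mod_cast hc
    linarith) (by nlinarith)
  rw [hcard (fun x => Γ.Adj x.1 x.2)] at hlow
  have hup : ∑ u ∈ S, ((univ.filter fun w => Boost R' u w ∧ Γ.Adj u w).card : ℝ) ≤
      S.card • ((1 / 2 - γ) * ((1 + 2 * ε) * p * n)) := by
    refine sum_le_card_nsmul _ _ _ fun u _ => ?_
    have h4 : (univ.filter fun w => Boost R' u w ∧ Γ.Adj u w) ⊆ nb Γ u \ nb G u := by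
      intro w hw
      simp only [mem_filter, mem_univ, true_and] at hw
      rw [Finset.mem_sdiff, mem_nb, mem_nb]
      exact ⟨hw.2, hcon u w hw.1⟩
    have h5 : ((univ.filter fun w => Boost R' u w ∧ Γ.Adj u w).card : ℝ) ≤ (nb Γ u \ nb G u).card := by
      exact_mod_cast card_le_card h4
    refine h5.trans ((hG u).trans ?_)
    exact mul_le_mul_of_nonneg_left (hdeg u) (by linarith)
  rw [nsmul_eq_mul] at hup
  have hSpos : 0 < (S.card : ℝ) := by linarith
  have h6 : (1 - 3 * ε) * p * ((S.card : ℝ) * (n / 2)) ≤ S.card * ((1 / 2 - γ) * ((1 + 2 * ε) * p * n)) := by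
    refine le_trans ?_ (hlow.trans hup)
    apply mul_le_mul_of_nonneg_left hF
    apply mul_nonneg _ hp.le
    linarith
  have h7 : S.card * p * n * ((1 - 3 * ε) / 2 - (1 / 2 - γ) * (1 + 2 * ε)) ≤ 0 := by nlinarith
  have h8 : 0 < (1 - 3 * ε) / 2 - (1 / 2 - γ) * (1 + 2 * ε) := by nlinarith
  have : 0 < S.card * p * n := by positivity
  nlinarith [mul_pos this h8]
end fin
end partF

section partP
open Finset

section ev
variable {V : Type*} [Fintype V] [DecidableEq V]

/-- graph of an outcome -/
def grf (ω : Sym2 V → Bool) : SimpleGraph V := SimpleGraph.fromRel fun u v => ω s(u, v) = true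

theorem grf_adj {ω : Sym2 V → Bool} {u v : V} : (grf ω).Adj u v ↔ u ≠ v ∧ ω s(u, v) = true := by
  unfold grf
  rw [SimpleGraph.fromRel_adj, Sym2.eq_swap (a := v) (b := u), or_self]

theorem inf_grf_adj {G : SimpleGraph V} {ω : Sym2 V → Bool} {u v : V} :
    (G ⊓ grf ω).Adj u v ↔ G.Adj u v ∧ ω s(u, v) = true := by
  rw [SimpleGraph.inf_adj, grf_adj]
  exact ⟨fun h => ⟨h.1, h.2.2⟩, fun h => ⟨h.1, h.1.ne, h.2⟩⟩

open Classical in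
/-- ordered adjacent pairs -/
noncomputable def pr (G : SimpleGraph V) (A B : Finset V) : Finset (V × V) :=
  (A ×ˢ B).filter fun x => G.Adj x.1 x.2

theorem eG_pr (G : SimpleGraph V) (A B : Finset V) : eG G A B = (pr G A B).card := rfl

theorem eG_inf (G : SimpleGraph V) (ω : Sym2 V → Bool) (A B : Finset V) :
    eG (G ⊓ grf ω) A B = ((pr G A B).filter fun x => ω s(x.1, x.2) = true).card := by
  classical
  unfold eG pr
  rw [filter_filter]
  congr 1
  ext x
  simp only [mem_filter, inf_grf_adj]

theorem nb_eG (G : SimpleGraph V) (v : V) : (nb G v).card = eG G {v} univ := by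
  rw [eG_eq_sum]; simp

theorem sum_setexp (a : ℝ) : ∑ A : Finset V, a ^ A.card = (a + 1) ^ Fintype.card V := by
  have h2 := Finset.prod_add_one (f := fun _ : V => a) (s := univ)
  simp only [prod_const, powerset_univ, card_univ] at h2
  exact h2.symm

theorem ev_U {p ε : ℝ} (h0 : 0 ≤ p) (h1 : p ≤ 1) (he : 0 < ε) (he1 : ε ≤ 1) (G : SimpleGraph V) :
    Pr p {ω | ∃ A B, (1 + ε) * p * eG G A B + 6 / ε * Fintype.card V ≤ eG (G ⊓ grf ω) A B} ≤
      Real.exp (-(Fintype.card V)) := by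
  have h := Pr_biUnion (E := Sym2 V) h0 h1 (univ : Finset (Finset V × Finset V))
    fun x => {ω | (1 + ε) * p * eG G x.1 x.2 + 6 / ε * Fintype.card V ≤ eG (G ⊓ grf ω) x.1 x.2}
  refine (Pr_mono h0 h1 ?_).trans (h.trans ?_)
  · rintro ω ⟨A, B, hAB⟩
    exact ⟨(A, B), mem_univ _, hAB⟩
  · have h2 : ∀ x ∈ (univ : Finset (Finset V × Finset V)), Pr p {ω | (1 + ε) * p * eG G x.1 x.2 + 6 / ε * Fintype.card V ≤ eG (G ⊓ grf ω) x.1 x.2} ≤ Real.exp (-(3 * Fintype.card V)) := by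
      rintro ⟨A, B⟩ -
      have := pairs_upper (t := 6 / ε * Fintype.card V) h0 h1 he he1 (pr G A B)
      simp only [← eG_inf, ← eG_pr] at this
      refine this.trans (le_of_eq ?_)
      congr 1
      field_simp
      ring
    refine (sum_le_card_nsmul _ _ _ h2).trans ?_
    rw [card_univ, Fintype.card_prod, Fintype.card_finset, nsmul_eq_mul]
    push_cast
    have h4 : (2 : ℝ) ≤ Real.exp 1 := by have := Real.add_one_le_exp (1 : ℝ); linarith
    have h5 : (2 : ℝ) ^ Fintype.card V ≤ Real.exp (Fintype.card V) := by
      calc (2 : ℝ) ^ Fintype.card V ≤ (Real.exp 1) ^ Fintype.card V := pow_le_pow_left₀ (by norm_num) h4 _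
        _ = _ := by rw [← Real.exp_nat_mul, mul_one]
    calc (2 : ℝ) ^ Fintype.card V * 2 ^ Fintype.card V * Real.exp (-(3 * Fintype.card V))
        ≤ Real.exp (Fintype.card V) * Real.exp (Fintype.card V) * Real.exp (-(3 * Fintype.card V)) := by
          gcongr
      _ = _ := by rw [← Real.exp_add, ← Real.exp_add]; congr 1; ring

theorem ev_dL {p ε D : ℝ} (h0 : 0 ≤ p) (h1 : p ≤ 1) (he : 0 < ε) (he1 : ε ≤ 1) (G : SimpleGraph V)
    (hD : ∀ v, D ≤ p * (nb G v).card) :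
    Pr p {ω | ∃ v, ((nb (G ⊓ grf ω) v).card : ℝ) ≤ (1 - 2 * ε) * p * (nb G v).card} ≤
      Fintype.card V * Real.exp (-(ε ^ 2 / 2 * D)) := by
  have h := Pr_biUnion (E := Sym2 V) h0 h1 (univ : Finset V)
    fun v => {ω | ((nb (G ⊓ grf ω) v).card : ℝ) ≤ (1 - 2 * ε) * p * (nb G v).card}
  refine (Pr_mono h0 h1 ?_).trans (h.trans ?_)
  · rintro ω ⟨v, hv⟩
    exact ⟨v, mem_univ _, hv⟩
  · rw [← nsmul_eq_mul, ← card_univ]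
    refine sum_le_card_nsmul _ _ _ fun v _ => ?_
    have := pairs_lower (t := ε * p * (nb G v).card) h0 h1 he he1 (pr G {v} univ) ∅ (by simp)
    simp only [← eG_inf, ← eG_pr, ← nb_eG, notMem_empty, card_empty, pow_zero, one_mul] at this
    refine (Pr_mono h0 h1 ?_).trans (this.trans ?_)
    · intro ω hω
      refine ⟨by simp, ?_⟩
      have : ((nb (G ⊓ grf ω) v).card : ℝ) ≤ (1 - 2 * ε) * p * (nb G v).card := hω
      linarith
    · apply Real.exp_le_exp.mpr
      nlinarith [hD v, sq_nonneg ε]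

theorem ev_dU {p ε D : ℝ} (h0 : 0 ≤ p) (h1 : p ≤ 1) (he : 0 < ε) (he1 : ε ≤ 1) (G : SimpleGraph V)
    (hD : ∀ v, D ≤ p * (nb G v).card) :
    Pr p {ω | ∃ v, (1 + 2 * ε) * p * (nb G v).card ≤ ((nb (G ⊓ grf ω) v).card : ℝ)} ≤
      Fintype.card V * Real.exp (-(ε ^ 2 / 2 * D)) := by
  have h := Pr_biUnion (E := Sym2 V) h0 h1 (univ : Finset V)
    fun v => {ω | (1 + 2 * ε) * p * (nb G v).card ≤ ((nb (G ⊓ grf ω) v).card : ℝ)}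
  refine (Pr_mono h0 h1 ?_).trans (h.trans ?_)
  · rintro ω ⟨v, hv⟩
    exact ⟨v, mem_univ _, hv⟩
  · rw [← nsmul_eq_mul, ← card_univ]
    refine sum_le_card_nsmul _ _ _ fun v _ => ?_
    have := pairs_upper (t := ε * p * (nb G v).card) h0 h1 he he1 (pr G {v} univ)
    simp only [← eG_inf, ← eG_pr, ← nb_eG] at this
    refine (Pr_mono h0 h1 ?_).trans (this.trans ?_)
    · intro ω hω
      have : (1 + 2 * ε) * p * (nb G v).card ≤ ((nb (G ⊓ grf ω) v).card : ℝ) := hω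
      show (1 + ε) * p * (nb G v).card + ε * p * (nb G v).card ≤ ((nb (G ⊓ grf ω) v).card : ℝ)
      linarith
    · apply Real.exp_le_exp.mpr
      nlinarith [hD v, sq_nonneg ε]

theorem ev_4 {p ε : ℝ} (h0 : 0 ≤ p) (h1 : p ≤ 1) (he : 0 < ε) (he1 : ε ≤ 1) (G : SimpleGraph V)
    (hn : 1 ≤ Fintype.card V) :
    Pr p {ω | ∃ A B, (1 + ε) * p * eG G A B + 4 / ε * Real.log (Fintype.card V) * (A.card + B.card + 1)
      ≤ eG (G ⊓ grf ω) A B} ≤ 9 / (Fintype.card V : ℝ) := by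
  set n : ℝ := ((Fintype.card V : ℕ) : ℝ) with hnn
  have hn1 : 1 ≤ n := by rw [hnn]; exact_mod_cast hn
  have hn0 : 0 < n := by linarith
  have h := Pr_biUnion (E := Sym2 V) h0 h1 (univ : Finset (Finset V × Finset V))
    fun x => {ω | (1 + ε) * p * eG G x.1 x.2 + 4 / ε * Real.log n * (x.1.card + x.2.card + 1) ≤ eG (G ⊓ grf ω) x.1 x.2}
  refine (Pr_mono h0 h1 ?_).trans (h.trans ?_)
  · rintro ω ⟨A, B, hAB⟩
    exact ⟨(A, B), mem_univ _, hAB⟩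
  · have h2 : ∀ x ∈ (univ : Finset (Finset V × Finset V)), Pr p {ω | (1 + ε) * p * eG G x.1 x.2 + 4 / ε * Real.log n * (x.1.card + x.2.card + 1) ≤ eG (G ⊓ grf ω) x.1 x.2} ≤ (n⁻¹ ^ 2) * ((n⁻¹ ^ 2) ^ x.1.card * (n⁻¹ ^ 2) ^ x.2.card) := by
      rintro ⟨A, B⟩ -
      have := pairs_upper (t := 4 / ε * Real.log n * (A.card + B.card + 1)) h0 h1 he he1 (pr G A B)
      simp only [← eG_inf, ← eG_pr] at this
      refine this.trans (le_of_eq ?_)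
      have h3 : -(ε / 2) * (4 / ε * Real.log n * (A.card + B.card + 1)) =
        ((2 * (A.card + B.card + 1) : ℕ) : ℝ) * Real.log n⁻¹ := by
        rw [Real.log_inv]; push_cast; field_simp; ring
      rw [h3, Real.exp_nat_mul, Real.exp_log (by positivity)]
      ring
    refine (sum_le_sum h2).trans ?_
    rw [← mul_sum, ← univ_product_univ, sum_product]
    simp only []
    rw [← sum_mul_sum, sum_setexp]
    have h5 : (n⁻¹ ^ 2 + 1) ^ Fintype.card V ≤ 3 := by
      have h6 : (n⁻¹ ^ 2 + 1) ^ Fintype.card V ≤ Real.exp 1 := by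
        calc (n⁻¹ ^ 2 + 1) ^ Fintype.card V ≤ (Real.exp (n⁻¹ ^ 2)) ^ Fintype.card V :=
              pow_le_pow_left₀ (by positivity) (Real.add_one_le_exp _) _
          _ = Real.exp (n * n⁻¹ ^ 2) := by rw [← Real.exp_nat_mul]
          _ ≤ Real.exp 1 := by
            apply Real.exp_le_exp.mpr
            have : n * n⁻¹ ^ 2 = n⁻¹ := by field_simp
            rw [this]; exact inv_le_one_of_one_le₀ hn1
      have := Real.exp_one_lt_d9
      linarith
    have h7 : (0:ℝ) ≤ (n⁻¹ ^ 2 + 1) ^ Fintype.card V := by positivity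
    have h8 : n⁻¹ ^ 2 ≤ n⁻¹ := by
      have := inv_le_one_of_one_le₀ hn1
      have : 0 < n⁻¹ := by positivity
      nlinarith
    rw [div_eq_mul_inv]
    have : (n⁻¹ ^ 2 + 1) ^ Fintype.card V * (n⁻¹ ^ 2 + 1) ^ Fintype.card V ≤ 9 := by nlinarith
    nlinarith [sq_nonneg n⁻¹]

open Classical in
/-- the pairs of interest for an edge set -/
noncomputable def Pf (R : Finset (Sym2 V)) : Finset (V × V) :=
  (BF (SimpleGraph.fromEdgeSet (R : Set (Sym2 V)))).filter fun x => x.1 ≠ x.2 ∧ s(x.1, x.2) ∉ R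

theorem ev_2 {p ε y δ : ℝ} (h0 : 0 ≤ p) (h1 : p ≤ 1) (he : 0 < ε) (he1 : ε ≤ 1)
    (hn : 1 ≤ Fintype.card V) (hy : 0 ≤ y) (hy1 : Real.exp (-y) ≤ ε ^ 2 / 64)
    (hδ : 2 * δ * y ≤ ε ^ 2 / 64) :
    Pr p {ω | ∃ R : Finset (Sym2 V), (R.card : ℝ) ≤ 2 * δ * p * (Fintype.card V : ℝ) ^ 2 ∧
      (Fintype.card V : ℝ) ^ 2 / 8 ≤ (Pf R).card ∧ (∀ e ∈ R, ω e = true) ∧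
      (((Pf R).filter fun x => ω s(x.1, x.2) = true).card : ℝ) ≤ (1 - 2 * ε) * p * (Pf R).card} ≤
      Real.exp (-(ε ^ 2 / 32 * p * (Fintype.card V : ℝ) ^ 2)) := by
  set n : ℝ := ((Fintype.card V : ℕ) : ℝ) with hnn
  have hn1 : 1 ≤ n := by rw [hnn]; exact_mod_cast hn
  set M := 2 * δ * p * n ^ 2 with hM
  have h := Pr_biUnion (E := Sym2 V) h0 h1
    ((univ : Finset (Finset (Sym2 V))).filter (fun R => (R.card : ℝ) ≤ M))
    fun R => {ω | n ^ 2 / 8 ≤ (Pf R).card ∧ (∀ e ∈ R, ω e = true) ∧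
      (((Pf R).filter fun x => ω s(x.1, x.2) = true).card : ℝ) ≤ (1 - 2 * ε) * p * (Pf R).card}
  refine (Pr_mono h0 h1 ?_).trans (h.trans ?_)
  · rintro ω ⟨R, hR, h2⟩
    exact ⟨R, by simpa using hR, h2⟩
  · have h2 : ∀ R ∈ ((univ : Finset (Finset (Sym2 V))).filter (fun R => (R.card : ℝ) ≤ M)),
        Pr p {ω | n ^ 2 / 8 ≤ (Pf R).card ∧ (∀ e ∈ R, ω e = true) ∧
      (((Pf R).filter fun x => ω s(x.1, x.2) = true).card : ℝ) ≤ (1 - 2 * ε) * p * (Pf R).card} ≤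
        p ^ R.card * Real.exp (-(ε ^ 2 / 16 * p * n ^ 2)) := by
      intro R _
      by_cases hc : n ^ 2 / 8 ≤ (Pf R).card
      · have := pairs_lower (t := ε * p * (Pf R).card) h0 h1 he he1 (Pf R) R (by
          intro x hx
          classical
          exact (mem_filter.mp hx).2.2)
        refine (Pr_mono h0 h1 ?_).trans (this.trans ?_)
        · rintro ω ⟨_, h3, h4⟩
          exact ⟨h3, by linarith⟩
        · apply mul_le_mul_of_nonneg_left _ (by positivity)
          apply Real.exp_le_exp.mpr
          have h9 : 0 ≤ ε ^ 2 * p := by positivity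
          nlinarith
      · refine le_trans (le_of_eq ?_) (show (0:ℝ) ≤ _ by positivity)
        simp [hc, Pr]
    refine (sum_le_sum h2).trans ?_
    rw [← sum_mul]
    refine (mul_le_mul_of_nonneg_right (sum_pow_small h0 hy) (Real.exp_pos _).le).trans ?_
    rw [← Real.exp_add]
    apply Real.exp_le_exp.mpr
    have hN : (Fintype.card (Sym2 V) : ℝ) ≤ n ^ 2 := by
      have h10 : (Fintype.card (Sym2 V)) ≤ Fintype.card V ^ 2 := by
        rw [Sym2.card, Nat.choose_two_right, Nat.add_sub_cancel]
        apply Nat.div_le_of_le_mul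
        nlinarith
      rw [hnn]; exact_mod_cast h10
    have h11 : p * Real.exp (-y) * Fintype.card (Sym2 V) ≤ p * (ε ^ 2 / 64) * n ^ 2 := by
      gcongr
    have h12 : y * M ≤ p * (ε ^ 2 / 64) * n ^ 2 := by
      have : 0 ≤ p * n ^ 2 := by positivity
      rw [hM]; nlinarith
    nlinarith

open Classical in
theorem ev_2_use {p ε δ : ℝ} (h0 : 0 < p) (h1 : p ≤ 1) (he : 0 < ε) (he1 : ε ≤ 1 / 4) (hδ0 : 0 < δ)
    (hδ : δ ≤ ε / 32) (hn : 8 / ε ≤ (Fintype.card V : ℝ)) {ω : Sym2 V → Bool}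
    (hω : ¬ ∃ R : Finset (Sym2 V), (R.card : ℝ) ≤ 2 * δ * p * (Fintype.card V : ℝ) ^ 2 ∧
      (Fintype.card V : ℝ) ^ 2 / 8 ≤ (Pf R).card ∧ (∀ e ∈ R, ω e = true) ∧
      (((Pf R).filter fun x => ω s(x.1, x.2) = true).card : ℝ) ≤ (1 - 2 * ε) * p * (Pf R).card)
    (R' : SimpleGraph V) (hR' : R' ≤ grf ω)
    (hM : ((Ef R').card : ℝ) ≤ 2 * δ * p * (Fintype.card V : ℝ) ^ 2)
    (hF : (Fintype.card V : ℝ) ^ 2 / 4 ≤ (BF R').card) :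
    (1 - 3 * ε) * p * (BF R').card ≤ (((BF R').filter fun x => (grf ω).Adj x.1 x.2).card : ℝ) := by
  set n : ℝ := ((Fintype.card V : ℕ) : ℝ) with hnn
  have hR : SimpleGraph.fromEdgeSet ((Ef R' : Finset (Sym2 V)) : Set (Sym2 V)) = R' := by
    have : ((Ef R' : Finset (Sym2 V)) : Set (Sym2 V)) = R'.edgeSet := by
      ext e; simp [Ef]
    rw [this, SimpleGraph.fromEdgeSet_edgeSet]
  have hPf : Pf (Ef R') = (BF R').filter fun x => x.1 ≠ x.2 ∧ s(x.1, x.2) ∉ Ef R' := by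
    unfold Pf; rw [hR]
  have hn8 : 8 ≤ ε * n := by rwa [div_le_iff₀' he] at hn
  have hc : ((BF R').card : ℝ) ≤ (Pf (Ef R')).card + n + 2 * (Ef R').card := by
    have hsub : BF R' ⊆ (Pf (Ef R') ∪ univ.image (fun v : V => (v, v))) ∪
        (univ.filter fun x : V × V => s(x.1, x.2) ∈ Ef R') := by
      intro x hx
      simp only [hPf, mem_union, mem_filter, mem_univ, true_and, mem_image]
      by_cases h1 : x.1 = x.2
      · left; right; exact ⟨x.1, Prod.ext rfl h1⟩
      · by_cases h2 : s(x.1, x.2) ∈ Ef R'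
        · right; exact h2
        · left; left; exact ⟨hx, h1, h2⟩
    have h2 : (univ.filter fun x : V × V => s(x.1, x.2) ∈ Ef R').card ≤ 2 * (Ef R').card := by
      refine card_le_mul_card_image_of_maps_to (f := fun x : V × V => s(x.1, x.2)) (t := Ef R') ?_ 2 ?_
      · intro x hx; exact (mem_filter.mp hx).2
      · intro e _
        have := mu_le (univ.filter fun x : V × V => s(x.1, x.2) ∈ Ef R') e
        unfold mu at this
        exact_mod_cast this
    have h3 : (univ.image (fun v : V => (v, v))).card ≤ Fintype.card V := card_image_le
    have h4 := (card_le_card hsub).trans ((card_union_le _ _).trans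
      (add_le_add ((card_union_le _ _).trans (add_le_add le_rfl h3)) h2))
    rw [hnn]; exact_mod_cast h4
  have hpn : p * n ^ 2 ≤ n ^ 2 := by nlinarith [sq_nonneg n]
  have hlow : (1 - ε) * (BF R').card ≤ ((Pf (Ef R')).card : ℝ) := by
    have h5 : 2 * ((Ef R').card : ℝ) ≤ ε / 8 * n ^ 2 := by
      have : δ * (p * n ^ 2) ≤ ε / 32 * n ^ 2 := mul_le_mul hδ hpn (by positivity) (by positivity)
      nlinarith
    have h6 : n ≤ ε / 8 * n ^ 2 := by
      have : 0 ≤ n := by positivity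
      nlinarith
    nlinarith
  have hX : (1 - 2 * ε) * p * (Pf (Ef R')).card < (((Pf (Ef R')).filter fun x => ω s(x.1, x.2) = true).card : ℝ) := by
    by_contra hcon
    push Not at hcon
    refine hω ⟨Ef R', hM, ?_, ?_, hcon⟩
    · nlinarith [sq_nonneg n]
    · intro e he
      simp only [Ef, mem_filter, mem_univ, true_and] at he
      induction e with | h a b
      rw [SimpleGraph.mem_edgeSet] at he
      exact (grf_adj.mp (hR' he)).2
  have hfin : (((Pf (Ef R')).filter fun x => ω s(x.1, x.2) = true).card : ℝ) ≤
      (((BF R').filter fun x => (grf ω).Adj x.1 x.2).card : ℝ) := by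
    have : (Pf (Ef R')).filter (fun x => ω s(x.1, x.2) = true) ⊆ (BF R').filter fun x => (grf ω).Adj x.1 x.2 := by
      intro x hx
      rw [hPf] at hx
      simp only [mem_filter, grf_adj] at hx ⊢
      exact ⟨hx.1.1, hx.1.2.1, hx.2⟩
    exact_mod_cast card_le_card this
  refine le_trans ?_ (hX.le.trans hfin)
  have h7 : 0 ≤ (1 - 2 * ε) * p := mul_nonneg (by linarith) h0.le
  have h8 := mul_le_mul_of_nonneg_left hlow h7
  have h9 : 0 ≤ p * (BF R').card * ε ^ 2 := by positivity
  nlinarith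
end ev
end partP

section partS
open Finset

section sp
variable {V : Type*} [Fintype V] [DecidableEq V]

theorem Ef_le (R : SimpleGraph V) : (Ef R).card ≤ eG R univ univ := by
  classical
  rw [eG_pr]
  refine (card_le_card ?_).trans (card_image_le (f := fun x : V × V => s(x.1, x.2)))
  intro e he
  simp only [Ef, mem_filter, mem_univ, true_and] at he
  induction e with | h a b
  rw [SimpleGraph.mem_edgeSet] at he
  exact mem_image.mpr ⟨(a, b), by simpa [pr] using he, rfl⟩

theorem eG_mono_graph {G H : SimpleGraph V} (h : G ≤ H) (A B : Finset V) : eG G A B ≤ eG H A B := by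
  classical
  unfold eG
  refine card_le_card ?_
  intro x hx
  rw [mem_filter] at *
  exact ⟨hx.1, h hx.2⟩

/-- existence of a sparse subgraph -/
theorem exists_sparse {G : SimpleGraph V} {ε δ D : ℝ} (he : 0 < ε) (he1 : ε ≤ 1) (hδ : 0 ≤ δ) (hδ1 : δ ≤ 1)
    (h3 : 3 ≤ Fintype.card V) (hD : ∀ v, D ≤ δ * (nb G v).card)
    (hD2 : 2 * Real.log (Fintype.card V) ≤ ε ^ 2 / 2 * D) :
    ∃ R ≤ G, (∀ v, (1 - 2 * ε) * δ * (nb G v).card ≤ ((nb R v).card : ℝ)) ∧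
      ∀ A B, (eG R A B : ℝ) ≤ (1 + ε) * δ * eG G A B + 6 / ε * Fintype.card V := by
  set n : ℝ := ((Fintype.card V : ℕ) : ℝ) with hnn
  have hn3 : (3 : ℝ) ≤ n := by rw [hnn]; exact_mod_cast h3
  have h1 := ev_dL hδ hδ1 he he1 G hD
  have h2 := ev_U hδ hδ1 he he1 G
  rw [← hnn] at h1 h2
  have h4 : n * Real.exp (-(ε ^ 2 / 2 * D)) ≤ 1 / 3 := by
    have : Real.exp (-(ε ^ 2 / 2 * D)) ≤ n⁻¹ ^ 2 := by
      rw [← Real.exp_log (show 0 < n⁻¹ ^ 2 by positivity), Real.log_pow, Real.log_inv]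
      apply Real.exp_le_exp.mpr
      push_cast; linarith
    calc _ ≤ n * n⁻¹ ^ 2 := mul_le_mul_of_nonneg_left this (by positivity)
      _ = n⁻¹ := by field_simp
      _ ≤ 1 / 3 := by rw [one_div]; exact inv_anti₀ (by norm_num) hn3
  have h5 : Real.exp (-n) ≤ 1 / 3 := by
    rw [Real.exp_neg, one_div]
    apply inv_anti₀ (by norm_num)
    have := Real.add_one_le_exp n; linarith
  set A1 := {ω : Sym2 V → Bool | ∃ v, ((nb (G ⊓ grf ω) v).card : ℝ) ≤ (1 - 2 * ε) * δ * (nb G v).card} with hA1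
  set A2 := {ω : Sym2 V → Bool | ∃ A B, (1 + ε) * δ * eG G A B + 6 / ε * n ≤ eG (G ⊓ grf ω) A B} with hA2
  have h6 : Pr δ (A1 ∪ A2) < 1 := by
    have := Pr_union hδ hδ1 A1 A2
    linarith
  have h7 : ∃ ω, ω ∉ A1 ∪ A2 := by
    by_contra hcon
    push Not at hcon
    have : A1 ∪ A2 = Set.univ := Set.eq_univ_of_forall hcon
    rw [this, Pr_univ] at h6
    exact lt_irrefl _ h6
  obtain ⟨ω, hω⟩ := h7
  rw [Set.mem_union, not_or] at hω
  refine ⟨G ⊓ grf ω, inf_le_left, fun v => ?_, fun A B => ?_⟩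
  · by_contra hc
    push Not at hc
    exact hω.1 ⟨v, hc.le⟩
  · by_contra hc
    push Not at hc
    exact hω.2 ⟨A, B, hc.le⟩

set_option maxHeartbeats 4000000 in
open Classical in
theorem good_ham {ε δ C p : ℝ} (he : 0 < ε) (he1 : ε ≤ 1 / 64) (hδ : 0 < δ) (hδ1 : δ ≤ ε / 32)
    (hC : 10000 ≤ ε ^ 3 * δ ^ 2 * C) (hp0 : 0 < p)
    (h3 : 3 ≤ Fintype.card V) (hp : C * Real.log (Fintype.card V) ≤ p * Fintype.card V)
    (hn1 : 8 / ε ≤ (Fintype.card V : ℝ))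
    (hn2 : (6 / ε + 3) * Real.log (Fintype.card V) ≤ ε * Fintype.card V)
    {Γ G : SimpleGraph V} (hGΓ : G ≤ Γ)
    (hG : ∀ v, ((nb Γ v \ nb G v).card : ℝ) ≤ (1 / 2 - 16 * ε) * (nb Γ v).card)
    (hdegU : ∀ v, ((nb Γ v).card : ℝ) ≤ (1 + 2 * ε) * p * Fintype.card V)
    (hdegL : ∀ v, (1 - 2 * ε) * p * (Fintype.card V - 1) ≤ ((nb Γ v).card : ℝ))
    (hE2 : ∀ R' : SimpleGraph V, R' ≤ Γ → ((Ef R').card : ℝ) ≤ 2 * δ * p * (Fintype.card V : ℝ) ^ 2 →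
      (Fintype.card V : ℝ) ^ 2 / 4 ≤ (BF R').card →
      (1 - 3 * ε) * p * (BF R').card ≤ (((BF R').filter fun x => Γ.Adj x.1 x.2).card : ℝ))
    (hE3 : ∀ A B, (eG Γ A B : ℝ) ≤ (1 + ε) * p * (A.card * B.card) + 6 / ε * Fintype.card V)
    (hE4 : ∀ A B, (eG Γ A B : ℝ) ≤ (1 + ε) * p * (A.card * B.card) +
      4 / ε * Real.log (Fintype.card V) * (A.card + B.card + 1)) : G.IsHamiltonian := by
  set n : ℝ := ((Fintype.card V : ℕ) : ℝ) with hnn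
  set l := Real.log n with hl
  have hn3 : (3 : ℝ) ≤ n := by rw [hnn]; exact_mod_cast h3
  have hn0 : 0 < n := by linarith
  have hl1 : 1 ≤ l := by
    rw [hl, Real.le_log_iff_exp_le hn0]
    have := Real.exp_one_lt_d9; linarith
  have hδ' : δ ≤ 1 := by linarith
  have hn8 : 8 ≤ ε * n := by rwa [div_le_iff₀' he] at hn1
  have k3 : 10000 * l ≤ ε ^ 3 * δ ^ 2 * (p * n) := by
    have h1 : ε ^ 3 * δ ^ 2 * (C * l) ≤ ε ^ 3 * δ ^ 2 * (p * n) :=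
      mul_le_mul_of_nonneg_left hp (by positivity)
    nlinarith
  have k2 : 10000 * l ≤ ε ^ 2 * δ * (p * n) := by
    refine k3.trans ?_
    have h1 : 0 ≤ ε ^ 2 * δ * (p * n) := by positivity
    have h2 : ε * δ ≤ 1 := by nlinarith
    nlinarith
  have k1 : 10000 * l ≤ ε * δ * (p * n) := by
    refine k2.trans ?_
    have h1 : 0 ≤ ε * δ * (p * n) := by positivity
    nlinarith
  have hpn : 0 < p * n := by positivity
  have hdpn : 0 < δ * (p * n) := by positivity
  have hdG : ∀ v, (1 / 2 + 13 * ε) * (p * n) ≤ ((nb G v).card : ℝ) := by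
    intro v
    have h1 : ((nb Γ v).card : ℝ) ≤ (nb G v).card + (nb Γ v \ nb G v).card := by
      have : nb Γ v ⊆ nb G v ∪ (nb Γ v \ nb G v) := by
        rw [union_sdiff_self_eq_union]; exact subset_union_right
      exact_mod_cast (card_le_card this).trans (card_union_le _ _)
    have h2 : (1 / 2 + 16 * ε) * (nb Γ v).card ≤ ((nb G v).card : ℝ) := by
      have := hG v; linarith
    have h4 : (1 - 3 * ε) * (p * n) ≤ ((nb Γ v).card : ℝ) := by
      refine le_trans ?_ (hdegL v)
      have : p ≤ p * (ε * n / 8) := by nlinarith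
      nlinarith [mul_pos hp0 he]
    refine le_trans ?_ h2
    have h5 := mul_le_mul_of_nonneg_left h4 (show 0 ≤ 1 / 2 + 16 * ε by linarith)
    nlinarith
  obtain ⟨R, hRG, hRd, hRU⟩ := exists_sparse (G := G) (δ := δ) (D := δ * (p * n) / 2) he (by linarith)
    hδ.le hδ' h3 (by
      intro v
      have := hdG v
      have h1 : (1 / 2) * (p * n) ≤ ((nb G v).card : ℝ) := by nlinarith
      nlinarith) (by
      rw [← hnn, ← hl]
      nlinarith)
  rw [← hnn] at hRU
  have hRΓ := hRG.trans hGΓ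
  set α := (1 + 3 * ε) * (δ * p) with hα
  set β := 18 / ε * n with hβ
  set s0 := δ * n / 48 with hs0
  set d := (1 / 2 + 11 * ε) * (δ * (p * n)) with hd
  have hδp : 0 < δ * p := by positivity
  have hα0 : 0 ≤ α := by rw [hα]; exact mul_nonneg (by linarith) hδp.le
  have hα2 : α ≤ 2 * (δ * p) := by rw [hα]; exact mul_le_mul_of_nonneg_right (by linarith) hδp.le
  have hβ0 : 0 ≤ β := by positivity
  have hs00 : 0 < s0 := by positivity
  have hdR : ∀ v, d ≤ ((nb R v).card : ℝ) := by
    intro v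
    refine le_trans ?_ (hRd v)
    have h1 := mul_le_mul_of_nonneg_left (hdG v) (show 0 ≤ (1 - 2 * ε) * δ from mul_nonneg (by linarith) hδ.le)
    refine le_trans ?_ h1
    rw [hd]
    have h2 : (1 / 2 + 11 * ε) ≤ (1 - 2 * ε) * (1 / 2 + 13 * ε) := by nlinarith
    have h4 := mul_le_mul_of_nonneg_right h2 hdpn.le
    linarith
  have hd2 : δ * (p * n) / 2 ≤ d := by rw [hd]; nlinarith
  have hU : ∀ A B : Finset V, (eG R A B : ℝ) ≤ α * A.card * B.card + β := by
    intro A B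
    have h1 : (eG G A B : ℝ) ≤ eG Γ A B := by exact_mod_cast eG_mono_graph hGΓ A B
    have h2 := h1.trans (hE3 A B)
    have h4 : 0 ≤ (1 + ε) * δ := by positivity
    have h5 := mul_le_mul_of_nonneg_left h2 h4
    refine (hRU A B).trans ?_
    have h6 : (1 + ε) * δ * ((1 + ε) * p * (A.card * B.card)) ≤ α * A.card * B.card := by
      have h7 : (0:ℝ) ≤ δ * p * (A.card * B.card) := by positivity
      have h8 : (1 + ε) * (1 + ε) ≤ 1 + 3 * ε := by nlinarith
      have h9 := mul_le_mul_of_nonneg_right h8 h7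
      rw [hα]; linarith
    have h10 : (1 + ε) * δ * (6 / ε * n) ≤ 2 * (6 / ε * n) := by
      apply mul_le_mul_of_nonneg_right _ (by positivity)
      nlinarith
    have h11 : β = 3 * (6 / ε * n) := by rw [hβ]; ring
    rw [h11]
    linarith
  have hexp : ∀ A : Finset V, A.Nonempty → (A.card : ℝ) ≤ s0 → 6 * A.card ≤ (nbS R A).card := by
    intro A hA hAs
    by_contra hcon
    push Not at hcon
    have hcR : ((nbS R A).card : ℝ) ≤ 6 * A.card := by exact_mod_cast hcon.le
    have hA1 : (1 : ℝ) ≤ A.card := by exact_mod_cast hA.card_pos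
    have h1 : d * A.card ≤ eG R A (nbS R A) := by
      rw [eG_eq_sum]
      push_cast
      rw [mul_comm, ← nsmul_eq_mul]
      refine card_nsmul_le_sum _ _ _ fun x hx => ?_
      have : nb R x ∩ nbS R A = nb R x := by
        rw [inter_eq_left]
        intro w hw
        rw [mem_nb] at hw
        simp only [nbS, mem_filter, mem_univ, true_and]
        exact ⟨x, hx, hw⟩
      rw [this]
      exact hdR x
    have h2 : (eG R A (nbS R A) : ℝ) ≤ eG Γ A (nbS R A) := by exact_mod_cast eG_mono_graph hRΓ _ _
    have h4 := h1.trans (h2.trans (hE4 A (nbS R A)))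
    have h5 : (1 + ε) * p * (A.card * (nbS R A).card) ≤ 2 * p * (A.card * (6 * s0)) := by
      have : ((nbS R A).card : ℝ) ≤ 6 * s0 := by linarith
      gcongr
      linarith
    have h6 : 4 / ε * l * (A.card + (nbS R A).card + 1) ≤ 4 / ε * l * (8 * A.card) := by
      apply mul_le_mul_of_nonneg_left _ (by positivity)
      linarith
    have h7 : 4 / ε * l * 8 < δ * (p * n) / 4 := by
      have : 4 / ε * l * 8 = 32 * l / ε := by ring
      rw [this, div_lt_iff₀ he]
      linarith
    have h8 : 4 / ε * l * (8 * A.card) < δ * (p * n) / 4 * A.card := by nlinarith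
    have h9 : 2 * p * (A.card * (6 * s0)) = δ * (p * n) / 4 * A.card := by rw [hs0]; ring
    have h10 : δ * (p * n) / 2 * A.card ≤ d * A.card := mul_le_mul_of_nonneg_right hd2 (by positivity)
    linarith
  have hM : ((Ef R).card : ℝ) + n ≤ 2 * δ * p * n ^ 2 := by
    have h1 : ((Ef R).card : ℝ) ≤ eG R univ univ := by exact_mod_cast Ef_le R
    have h2 := h1.trans (hU univ univ)
    rw [card_univ, ← hnn] at h2
    have h4 : 18 / ε + 1 ≤ (1 - 3 * ε) * (δ * (p * n)) := by
      have h5 : 10000 / ε ≤ δ * (p * n) := by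
        rw [div_le_iff₀ he]; nlinarith
      have h6 : 18 / ε = 18 * (1 / ε) := by ring
      have h7 : 10000 / ε = 10000 * (1 / ε) := by ring
      have h8 : 1 ≤ 1 / ε := by rw [le_div_iff₀ he]; linarith
      nlinarith
    have h9 := mul_le_mul_of_nonneg_right h4 hn0.le
    rw [hα, hβ] at h2
    nlinarith
  set K := 3 / ε with hK
  have hK1 : 1 ≤ K := by rw [hK, le_div_iff₀ he]; linarith
  set k := ⌈K * l⌉₊ with hk
  have hKl : 1 ≤ K * l := by nlinarith
  have hk1 : K * l ≤ k := Nat.le_ceil _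
  have hk2 : (k : ℝ) ≤ 2 * (K * l) := by
    have := (Nat.ceil_lt_add_one (show 0 ≤ K * l by linarith)).le
    linarith
  have hk0 : 0 < k := by
    have : (0:ℝ) < k := by linarith
    exact_mod_cast this
  have hkR : (0:ℝ) < k := by exact_mod_cast hk0
  set L := Fintype.card V / k + 1 with hL
  set T := Nat.log 2 (Fintype.card V) + 1 with hT
  have hLT : (L : ℝ) ≤ n / k + 1 := by
    rw [hL]; push_cast
    have : ((Fintype.card V / k : ℕ) : ℝ) ≤ n / k := Nat.cast_div_le
    linarith
  have hT2 : (T : ℝ) ≤ 3 * l := by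
    have h1 : 2 ^ Nat.log 2 (Fintype.card V) ≤ Fintype.card V := Nat.pow_log_le_self 2 (by omega)
    have h2 : ((2:ℝ) ^ Nat.log 2 (Fintype.card V)) ≤ n := by rw [hnn]; exact_mod_cast h1
    have h4 := Real.log_le_log (by positivity) h2
    rw [Real.log_pow] at h4
    have h5 := Real.log_two_gt_d9
    rw [hT]; push_cast
    have h6 : (0:ℝ) ≤ (Nat.log 2 (Fintype.card V) : ℝ) := by positivity
    nlinarith
  have hkLT : (k : ℝ) + L * T ≤ 2 * ε * n := by
    have h1 : (L : ℝ) * T ≤ (n / k + 1) * (3 * l) := by gcongr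
    have h2 : n / k * (3 * l) ≤ ε * n := by
      rw [div_mul_eq_mul_div, div_le_iff₀ hkR]
      have h4 : ε * (K * l) = 3 * l := by rw [hK]; field_simp
      have h5 : ε * n * (K * l) ≤ ε * n * k := mul_le_mul_of_nonneg_left hk1 (by positivity)
      nlinarith
    have h6 : 2 * (K * l) = 6 / ε * l := by rw [hK]; ring
    nlinarith
  refine det_main (Γ := Γ) (R := R) (α := α) (β := β) (d := d) (s0 := s0) (p := p) (ε := ε)
    (γ := 16 * ε) (M := 2 * δ * p * n ^ 2) (k := k) (L := L) (T := T) hp0 he le_rfl (by linarith) h3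
    hG hdegU hE2 hGΓ hRG hM hα0 hβ0 hs00 hexp hU hdR (Nat.succ_pos _) hk0 ?_ ?_ ?_
  · rw [hL]
    exact (Nat.lt_mul_div_succ _ hk0).le
  · rw [hT]; exact Nat.lt_pow_succ_log_self (by norm_num) _
  · rw [← hnn]
    have h1 : 3 * k * β / s0 ≤ 4 * ε * (δ * (p * n)) := by
      have h2 : 3 * k * β / s0 = 2592 * k / (ε * δ) := by
        rw [hβ, hs0]; field_simp; norm_num
      rw [h2, div_le_iff₀ (by positivity)]
      have h4 : ε * (2592 * k) ≤ 2592 * (6 * l) := by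
        have h5 : ε * (K * l) = 3 * l := by rw [hK]; field_simp
        nlinarith
      have h6 : ε * (2592 * k) ≤ ε * (4 * ε * (δ * (p * n)) * (ε * δ)) := by
        refine h4.trans ?_
        have : ε * (4 * ε * (δ * (p * n)) * (ε * δ)) = 4 * (ε ^ 3 * δ ^ 2 * (p * n)) := by ring
        rw [this]; linarith
      exact le_of_mul_le_mul_left h6 he
    have h2 : α * (n / 2 + k + L * T) ≤ (1 / 2 + 3 / 2 * ε) * (δ * (p * n)) + 4 * ε * (δ * (p * n)) := by
      have h4 : α * (k + L * T) ≤ 2 * (δ * p) * (2 * ε * n) := by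
        apply mul_le_mul hα2 hkLT (by positivity) (by positivity)
      have h5 : α * (n / 2) = (1 / 2 + 3 / 2 * ε) * (δ * (p * n)) := by rw [hα]; ring
      nlinarith
    have h4 : 0 < ε * (δ * (p * n)) := by positivity
    rw [hd]
    nlinarith
end sp
end partS

section final
open Finset
variable {V : Type*} [Fintype V] [DecidableEq V]

theorem eG_le_mul (G : SimpleGraph V) (A B : Finset V) : eG G A B ≤ A.card * B.card := by
  classical
  rw [← card_product]; unfold eG; exact card_le_card fun x hx => (mem_filter.mp hx).1

theorem eG_top_le (A B : Finset V) : (eG (⊤ : SimpleGraph V) A B : ℝ) ≤ A.card * B.card := by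
  exact_mod_cast eG_le_mul (⊤ : SimpleGraph V) A B

theorem nb_top_card (v : V) : ((nb (⊤ : SimpleGraph V) v).card : ℝ) = Fintype.card V - 1 := by
  classical
  have h : nb (⊤ : SimpleGraph V) v = univ.erase v := by
    ext w; rw [mem_nb]; simp [eq_comm]
  have h1 : 1 ≤ Fintype.card V := Fintype.card_pos_iff.mpr ⟨v⟩
  rw [h, card_erase_of_mem (mem_univ v), card_univ]
  push_cast [h1]; ring

theorem bad_small {ε δ C p y : ℝ} (he : 0 < ε) (he1 : ε ≤ 1 / 64) (hδ : 0 < δ) (hδ1 : δ ≤ ε / 32)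
    (hC : 10000 ≤ ε ^ 3 * δ ^ 2 * C) (hp1 : p ≤ 1)
    (hy : 0 ≤ y) (hy1 : Real.exp (-y) ≤ ε ^ 2 / 64) (hδy : 2 * δ * y ≤ ε ^ 2 / 64)
    (h3 : 3 ≤ Fintype.card V) (hp : C * Real.log (Fintype.card V) ≤ p * Fintype.card V)
    (hn1 : 8 / ε ≤ (Fintype.card V : ℝ))
    (hn2 : (6 / ε + 3) * Real.log (Fintype.card V) ≤ ε * Fintype.card V) :
    Pr p {ω : Sym2 V → Bool | ¬ ∀ G : SimpleGraph V, G ≤ grf ω →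
      (∀ v, ((nb (grf ω) v \ nb G v).card : ℝ) ≤ (1 / 2 - 16 * ε) * (nb (grf ω) v).card) →
      G.IsHamiltonian} ≤ 13 / (Fintype.card V : ℝ) := by
  set n : ℝ := ((Fintype.card V : ℕ) : ℝ) with hnn
  set l := Real.log n with hl
  have hn3 : (3 : ℝ) ≤ n := by rw [hnn]; exact_mod_cast h3
  have hn0 : 0 < n := by linarith
  have hl1 : 1 ≤ l := by
    rw [hl, Real.le_log_iff_exp_le hn0]
    have := Real.exp_one_lt_d9; linarith
  have hC2 : 10000 ≤ ε ^ 2 * C := by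
    have hC0 : 0 < C := by
      by_contra hcon
      push Not at hcon
      have : ε ^ 3 * δ ^ 2 * C ≤ 0 := mul_nonpos_of_nonneg_of_nonpos (by positivity) hcon
      linarith
    refine hC.trans ?_
    have h1 : ε * δ ^ 2 ≤ 1 := by
      have : δ ^ 2 ≤ 1 := pow_le_one₀ hδ.le (by linarith)
      nlinarith
    have h2 : 0 ≤ ε ^ 2 * C := by positivity
    nlinarith
  have hpn : 10000 * l ≤ ε ^ 2 * (p * n) := by
    have := mul_le_mul_of_nonneg_left hp (sq_nonneg ε)
    nlinarith
  have hp0 : 0 < p := by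
    by_contra hcon
    push Not at hcon
    have : ε ^ 2 * (p * n) ≤ 0 := mul_nonpos_of_nonneg_of_nonpos (by positivity)
      (mul_nonpos_of_nonpos_of_nonneg hcon hn0.le)
    linarith
  have heps : ε ≤ 1 := by linarith
  have hD : ∀ v, p * n / 2 ≤ p * ((nb (⊤ : SimpleGraph V) v).card : ℝ) := by
    intro v
    rw [nb_top_card, ← hnn, mul_div_assoc]
    apply mul_le_mul_of_nonneg_left _ hp0.le
    linarith
  have e1 := ev_dL hp0.le hp1 he heps (⊤ : SimpleGraph V) hD
  have e2 := ev_dU hp0.le hp1 he heps (⊤ : SimpleGraph V) hD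
  have e3 := ev_U hp0.le hp1 he heps (⊤ : SimpleGraph V)
  have e4 := ev_4 hp0.le hp1 he heps (⊤ : SimpleGraph V) (by omega)
  have e5 := ev_2 (V := V) hp0.le hp1 he heps (by omega) hy hy1 hδy
  simp only [top_inf_eq, ← hnn] at e1 e2 e3 e4 e5
  rw [← hl] at e4
  have b1 : n * Real.exp (-(ε ^ 2 / 2 * (p * n / 2))) ≤ 1 / n := by
    have : Real.exp (-(ε ^ 2 / 2 * (p * n / 2))) ≤ n⁻¹ ^ 2 := by
      rw [← Real.exp_log (show 0 < n⁻¹ ^ 2 by positivity), Real.log_pow, Real.log_inv]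
      apply Real.exp_le_exp.mpr
      push_cast
      rw [← hl]; linarith
    calc _ ≤ n * n⁻¹ ^ 2 := mul_le_mul_of_nonneg_left this (by positivity)
      _ = 1 / n := by field_simp
  have b3 : Real.exp (-n) ≤ 1 / n := by
    rw [Real.exp_neg, one_div]
    apply inv_anti₀ hn0
    have := Real.add_one_le_exp n; linarith
  have b5 : Real.exp (-(ε ^ 2 / 32 * p * n ^ 2)) ≤ 1 / n := by
    refine le_trans (Real.exp_le_exp.mpr ?_) b3
    have h1 : 1 ≤ ε ^ 2 * (p * n) / 32 := by linarith
    have h2 := mul_le_mul_of_nonneg_right h1 hn0.le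
    nlinarith
  have hub : ∀ (A1 A2 A3 A4 A5 : Set (Sym2 V → Bool)), Pr p (A1 ∪ (A2 ∪ (A3 ∪ (A4 ∪ A5)))) ≤
      Pr p A1 + (Pr p A2 + (Pr p A3 + (Pr p A4 + Pr p A5))) := by
    intro A1 A2 A3 A4 A5
    have u := @Pr_union (Sym2 V) _ _ p hp0.le hp1
    linarith [u A1 (A2 ∪ (A3 ∪ (A4 ∪ A5))), u A2 (A3 ∪ (A4 ∪ A5)), u A3 (A4 ∪ A5), u A4 A5]
  refine le_trans (Pr_mono hp0.le hp1 ?_) ((hub _ _ _ _ _).trans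
    ((add_le_add e1 (add_le_add e2 (add_le_add e3 (add_le_add e4 e5)))).trans ?_))
  · intro ω hω
    by_contra hcon
    simp only [Set.mem_union, not_or, Set.mem_setOf_eq] at hcon
    obtain ⟨c1, c2, c3, c4, c5⟩ := hcon
    apply hω
    intro G hG hdel
    push Not at c1 c2 c3 c4
    refine good_ham he he1 hδ hδ1 hC hp0 h3 hp hn1 hn2 hG hdel ?_ ?_ ?_ ?_ ?_
    · intro v
      refine (c2 v).le.trans ?_
      rw [nb_top_card, ← hnn]
      apply mul_le_mul_of_nonneg_left (by linarith)
      positivity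
    · intro v
      have := (c1 v).le
      rwa [nb_top_card, ← hnn] at this
    · intro R' h1 h2 h4
      exact ev_2_use hp0 hp1 he (by linarith) hδ hδ1 hn1 c5 R' h1 h2 h4
    · intro A B
      refine (c3 A B).le.trans ?_
      have := mul_le_mul_of_nonneg_left (eG_top_le A B) (show 0 ≤ (1 + ε) * p by positivity)
      linarith
    · intro A B
      refine (c4 A B).le.trans ?_
      have := mul_le_mul_of_nonneg_left (eG_top_le A B) (show 0 ≤ (1 + ε) * p by positivity)
      linarith
  · have : 13 / n = 1 / n + (1 / n + (1 / n + (9 / n + 1 / n))) := by ring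
    rw [this]
    linarith

theorem gnp_eq {n : ℕ} {p : ℝ} (h0 : 0 ≤ p) (h1 : p ≤ 1) (A : Set (Sym2 (Fin n) → Bool)) :
    gnp n p A = ENNReal.ofReal (Pr p A) := by
  classical
  have hmin : min (ENNReal.ofReal p) 1 = ENNReal.ofReal p :=
    min_eq_left (by rw [← ENNReal.ofReal_one]; exact ENNReal.ofReal_le_ofReal h1)
  have hsub : 1 - ENNReal.ofReal p = ENNReal.ofReal (1 - p) := by
    rw [ENNReal.ofReal_sub _ h0, ENNReal.ofReal_one]
  have hb : ∀ b : Bool, bernoulliMeasure p {b} = ENNReal.ofReal (if b = true then p else 1 - p) := by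
    intro b
    unfold bernoulliMeasure
    rw [hmin, hsub]
    cases b <;> simp
  haveI : IsFiniteMeasure (bernoulliMeasure p) := by
    refine ⟨?_⟩
    unfold bernoulliMeasure
    rw [hmin, hsub]
    simp
  have hs : ∀ ω, gnp n p {ω} = ENNReal.ofReal (Wt p ω) := by
    intro ω
    unfold gnp Wt
    rw [Measure.pi_singleton, ENNReal.ofReal_prod_of_nonneg]
    · exact prod_congr rfl fun e _ => hb _
    · intro e _; split_ifs <;> linarith
  have hA : A = ((univ.filter fun ω => ω ∈ A : Finset (Sym2 (Fin n) → Bool)) : Set _) := by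
    ext; simp
  rw [hA, ← sum_measure_singleton]
  unfold Pr
  simp only [← hA]
  rw [← sum_filter, ENNReal.ofReal_sum_of_nonneg fun ω _ => Wt_nonneg h0 h1 ω]
  exact sum_congr rfl fun ω _ => hs ω

theorem ncard_nb {n : ℕ} (G : SimpleGraph (Fin n)) (v : Fin n) :
    (G.neighborSet v).ncard = (nb G v).card := by
  rw [← Set.ncard_coe_finset]
  congr 1
  ext w; simp [mem_nb]

theorem ncard_nb_diff {n : ℕ} (H G : SimpleGraph (Fin n)) (v : Fin n) :
    (H.neighborSet v \ G.neighborSet v).ncard = (nb H v \ nb G v).card := by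
  rw [← Set.ncard_coe_finset]
  congr 1
  ext w; simp [mem_nb]

end final

/-- **Lee–Sudakov theorem (local resilience of Hamiltonicity).** For every `γ > 0` there is a
constant `C` such that if `p ≥ C·log n/n` then a.a.s. every spanning subgraph of `G(n,p)`
obtained by deleting at most `(1/2 - γ)·deg(v)` edges at every vertex `v` is Hamiltonian. -/
theorem stmt_16 (γ : ℝ) (hγ : 0 < γ) :
    ∃ C : ℝ, 0 < C ∧ ∀ p : ℕ → ℝ, (∀ n, 0 ≤ p n ∧ p n ≤ 1) →
      (∀ᶠ n : ℕ in atTop, C * Real.log n / n ≤ p n) →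
      Tendsto (fun n : ℕ => gnp n (p n)
        {ω | ∀ G : SimpleGraph (Fin n), G ≤ graphOf ω →
          (∀ v : Fin n, (((graphOf ω).neighborSet v \ G.neighborSet v).ncard : ℝ) ≤
            (1 / 2 - γ) * ((graphOf ω).neighborSet v).ncard) →
          G.IsHamiltonian}) atTop (𝓝 1) := by
  obtain ⟨ε, he, he1, heγ⟩ : ∃ ε : ℝ, 0 < ε ∧ ε ≤ 1 / 64 ∧ 16 * ε ≤ γ := by
    refine ⟨min γ (1 / 4) / 16, by positivity, ?_, ?_⟩
    · have := min_le_right γ (1 / 4); linarith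
    · have := min_le_left γ (1 / 4); linarith
  obtain ⟨y, hy, hy1⟩ : ∃ y : ℝ, 0 ≤ y ∧ Real.exp (-y) ≤ ε ^ 2 / 64 := by
    refine ⟨-Real.log (ε ^ 2 / 64), ?_, ?_⟩
    · have : Real.log (ε ^ 2 / 64) ≤ 0 := Real.log_nonpos (by positivity) (by nlinarith)
      linarith
    · rw [neg_neg, Real.exp_log (by positivity)]
  obtain ⟨δ, hδ, hδ1, hδy⟩ : ∃ δ : ℝ, 0 < δ ∧ δ ≤ ε / 32 ∧ 2 * δ * y ≤ ε ^ 2 / 64 := by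
    refine ⟨min (ε / 32) (ε ^ 2 / (128 * (y + 1))), by positivity, min_le_left _ _, ?_⟩
    have h1 := min_le_right (ε / 32) (ε ^ 2 / (128 * (y + 1)))
    calc 2 * min (ε / 32) (ε ^ 2 / (128 * (y + 1))) * y
        ≤ 2 * (ε ^ 2 / (128 * (y + 1))) * y := by gcongr
      _ = ε ^ 2 / 64 * (y / (y + 1)) := by field_simp; ring
      _ ≤ ε ^ 2 / 64 * 1 := by
        apply mul_le_mul_of_nonneg_left _ (by positivity)
        rw [div_le_one (by linarith)]; linarith
      _ = _ := mul_one _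
  have hC : (10000 : ℝ) ≤ ε ^ 3 * δ ^ 2 * (10000 / (ε ^ 3 * δ ^ 2)) := by
    rw [mul_div_cancel₀ _ (by positivity)]
  refine ⟨10000 / (ε ^ 3 * δ ^ 2), by positivity, fun p hp01 hp => ?_⟩
  set C := 10000 / (ε ^ 3 * δ ^ 2) with hCdef
  have hlog : ∀ᶠ n : ℕ in atTop, (6 / ε + 3) * Real.log n ≤ ε * n := by
    have h1 := (Real.isLittleO_log_id_atTop.comp_tendsto tendsto_natCast_atTop_atTop).bound
      (c := ε / (6 / ε + 3)) (by positivity)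
    filter_upwards [h1, eventually_ge_atTop 1] with n hn hn1
    simp only [Function.comp, id, Real.norm_eq_abs] at hn
    rw [abs_of_nonneg (Real.log_natCast_nonneg n), Nat.abs_cast, div_mul_eq_mul_div,
      le_div_iff₀ (by positivity)] at hn
    linarith
  have hev : ∀ᶠ n : ℕ in atTop, ENNReal.ofReal (1 - 13 / (n : ℝ)) ≤ gnp n (p n)
        {ω | ∀ G : SimpleGraph (Fin n), G ≤ graphOf ω →
          (∀ v : Fin n, (((graphOf ω).neighborSet v \ G.neighborSet v).ncard : ℝ) ≤
            (1 / 2 - γ) * ((graphOf ω).neighborSet v).ncard) →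
          G.IsHamiltonian} := by
    filter_upwards [hp, hlog, eventually_ge_atTop 3,
      tendsto_natCast_atTop_atTop.eventually_ge_atTop (8 / ε)] with n h1 h2 h3 h4
    have hn0 : (0 : ℝ) < n := by
      have : 0 < n := by omega
      exact_mod_cast this
    rw [div_le_iff₀ hn0] at h1
    have hb := bad_small (V := Fin n) (p := p n) he he1 hδ hδ1 hC (hp01 n).2 hy hy1 hδy
      (by simpa using h3) (by simpa using h1) (by simpa using h4) (by simpa using h2)
    rw [gnp_eq (hp01 n).1 (hp01 n).2]
    apply ENNReal.ofReal_le_ofReal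
    rw [Fintype.card_fin] at hb
    refine le_trans ?_ (Pr_mono (hp01 n).1 (hp01 n).2 (A := {ω | ¬ ∀ G : SimpleGraph (Fin n), G ≤ grf ω →
      (∀ v, ((nb (grf ω) v \ nb G v).card : ℝ) ≤ (1 / 2 - 16 * ε) * (nb (grf ω) v).card) →
      G.IsHamiltonian}ᶜ) ?_)
    · have := Pr_compl (p n) {ω : Sym2 (Fin n) → Bool | ¬ ∀ G : SimpleGraph (Fin n), G ≤ grf ω →
        (∀ v, ((nb (grf ω) v \ nb G v).card : ℝ) ≤ (1 / 2 - 16 * ε) * (nb (grf ω) v).card) →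
        G.IsHamiltonian}
      linarith
    · intro ω hω G hG hdel
      have hω' : ∀ G : SimpleGraph (Fin n), G ≤ grf ω →
        (∀ v, ((nb (grf ω) v \ nb G v).card : ℝ) ≤ (1 / 2 - 16 * ε) * (nb (grf ω) v).card) →
        G.IsHamiltonian := not_not.mp hω
      refine hω' G hG fun v => ?_
      have h5 := hdel v
      rw [ncard_nb, ncard_nb_diff] at h5
      refine h5.trans ?_
      apply mul_le_mul_of_nonneg_right (by linarith) (by positivity)
  refine tendsto_of_tendsto_of_tendsto_of_le_of_le' (g := fun n : ℕ => ENNReal.ofReal (1 - 13 / (n : ℝ)))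
    (h := fun _ => 1) ?_ tendsto_const_nhds hev (Eventually.of_forall fun n => ?_)
  · have h1 : Tendsto (fun n : ℕ => 1 - 13 / (n : ℝ)) atTop (𝓝 (1 - 0)) :=
      tendsto_const_nhds.sub (tendsto_const_div_atTop_nhds_zero_nat 13)
    have h2 := ENNReal.tendsto_ofReal h1
    simpa using h2
  · rw [gnp_eq (hp01 n).1 (hp01 n).2, ← ENNReal.ofReal_one]
    apply ENNReal.ofReal_le_ofReal
    rw [← Pr_univ (E := Sym2 (Fin n)) (p n)]
    exact Pr_mono (hp01 n).1 (hp01 n).2 (Set.subset_univ _)
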